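/- arXiv:2010.06843 — 2 statements merged into one kernel-verified Lean document; each statement's English description precedes it below -/
import Mathlib

section
/- Let δ > -1/2 and n ≥ 1. Then the operator f ↦ sup_{R>0} (R^{-1} ∫₀^R |B_t^δ f(x)|² dt)^{1/2} is bounded on L²(ℝⁿ), i.e. there exists C such that ‖ sup_{R>0} (R^{-1} ∫₀^R |B_t^δ f(·)|² dt)^{1/2} ‖_{L²} ≤ C ‖f‖_{L²} for all f ∈ 𝒮(ℝⁿ). -/
open MeasureTheory Real
open scoped ENNReal NNReal RealInnerProductSpace FourierTransform

/-- `pPow x γ = x^γ` for `x > 0` and `0` otherwise (the convention for `x₊^γ`). -/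
noncomputable def pPow (x γ : ℝ) : ℝ := if 0 < x then x ^ γ else 0

section Plancherel

variable {E : Type*} [NormedAddCommGroup E] [InnerProductSpace ℝ E] [FiniteDimensional ℝ E]
  [MeasurableSpace E] [BorelSpace E]

/-- The integral Fourier transform of a function in `L¹ ∩ L²` represents its `L²` Fourier
transform. -/
theorem fourier_toLp_ae_eq {h : E → ℂ} (h1 : Integrable h) (h2 : MemLp h 2) :
    (𝓕 (h2.toLp h) : Lp ℂ 2 (volume : Measure E)) =ᵐ[volume] 𝓕 h := by
  refine ae_eq_of_integral_contDiff_smul_eq ?_ ?_ ?_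
  · exact (Lp.memLp _).locallyIntegrable (by norm_num)
  · exact (VectorFourier.fourierIntegral_continuous Real.continuous_fourierChar
      continuous_inner h1).locallyIntegrable
  · intro g hg hgs
    have hgs' : HasCompactSupport (fun x => (g x : ℂ)) :=
      hgs.comp_left (g := fun y : ℝ => (y : ℂ)) (by simp)
    let G : SchwartzMap E ℂ := hgs'.toSchwartzMap (Complex.ofRealCLM.contDiff.comp hg)
    have hG : ∀ x, G x = (g x : ℂ) := fun x => rfl
    have key := congrArg (fun T => T G) (Lp.fourier_toTemperedDistribution_eq (h2.toLp h))
    simp only [TemperedDistribution.fourier_apply, Lp.toTemperedDistribution_apply] at key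
    have e1 : ∫ x, g x • ((𝓕 (h2.toLp h) : Lp ℂ 2 (volume : Measure E)) : E → ℂ) x
        = ∫ x, G x • ((𝓕 (h2.toLp h) : Lp ℂ 2 (volume : Measure E)) : E → ℂ) x := by
      simp [hG]
    have e2 : ∫ x, (𝓕 G) x • (h2.toLp h) x = ∫ x, (𝓕 G) x • h x := by
      refine integral_congr_ae ?_
      filter_upwards [h2.coeFn_toLp] with x hx
      rw [hx]
    have e3 : ∫ x, (𝓕 G) x • h x = ∫ x, G x • 𝓕 h x := by
      simpa using! VectorFourier.integral_fourierIntegral_smul_eq_flip (L := innerₗ E)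
        Real.continuous_fourierChar continuous_inner G.integrable h1
    rw [e1, ← key, e2, e3]
    simp [hG]

/-- Plancherel's theorem for functions in `L¹ ∩ L²`. -/
theorem lintegral_enorm_fourierInv_sq {h : E → ℂ} (h1 : Integrable h) (h2 : MemLp h 2) :
    ∫⁻ x, ‖𝓕⁻ h x‖ₑ ^ 2 = ∫⁻ x, ‖h x‖ₑ ^ 2 := by
  have key : eLpNorm (𝓕 h) 2 volume = eLpNorm h 2 volume := by
    rw [← eLpNorm_congr_ae (fourier_toLp_ae_eq h1 h2), ← Lp.enorm_def,
      ← eLpNorm_congr_ae h2.coeFn_toLp, ← Lp.enorm_def]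
    exact enorm_eq_iff_norm_eq.2 (Lp.norm_fourier_eq _)
  have hsq : ∀ u : E → ℂ, eLpNorm u 2 volume ^ 2 = ∫⁻ x, ‖u x‖ₑ ^ 2 := by
    intro u
    simpa using eLpNorm_nnreal_pow_eq_lintegral (f := u) (μ := volume) (p := 2) (by norm_num)
  simp_rw [Real.fourierInv_eq_fourier_neg]
  rw [lintegral_neg_eq_self (fun x => ‖𝓕 h x‖ₑ ^ 2), ← hsq, key, hsq]

end Plancherel

section PositiveKernels

variable {α : Type*} [MeasurableSpace α] {μ : Measure α}

/-- The Cauchy–Schwarz inequality for `ℝ≥0∞`-valued functions, in squared form. -/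
theorem lintegral_mul_sq_le {f g : α → ℝ≥0∞} (hf : AEMeasurable f μ) (hg : AEMeasurable g μ) :
    (∫⁻ x, f x * g x ∂μ) ^ 2 ≤ (∫⁻ x, f x ^ 2 ∂μ) * ∫⁻ x, g x ^ 2 ∂μ := by
  have h := ENNReal.lintegral_mul_le_Lp_mul_Lq μ Real.HolderConjugate.two_two hf hg
  simp only [ENNReal.rpow_ofNat] at h
  calc (∫⁻ x, f x * g x ∂μ) ^ 2
      ≤ ((∫⁻ x, f x ^ 2 ∂μ) ^ (1 / 2 : ℝ) * (∫⁻ x, g x ^ 2 ∂μ) ^ (1 / 2 : ℝ)) ^ 2 :=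
        pow_le_pow_left₀ zero_le h 2
    _ = _ := by
        rw [mul_pow, ← ENNReal.rpow_mul_natCast, ← ENNReal.rpow_mul_natCast]
        norm_num

/-- The average of `f` against the positive kernel `p`. -/
noncomputable def kernelAverage (μ : Measure α) (p : α → α → ℝ≥0∞) (f : α → ℝ≥0∞) (x : α) :
    ℝ≥0∞ :=
  ∫⁻ y, p x y * f y ∂μ

variable [SFinite μ]

theorem measurable_kernelAverage {p : α → α → ℝ≥0∞} (hp : Measurable (Function.uncurry p))
    {f : α → ℝ≥0∞} (hf : Measurable f) : Measurable (kernelAverage μ p f) :=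
  Measurable.lintegral_prod_right' (f := fun z : α × α => p z.1 z.2 * f z.2)
    (hp.mul (hf.comp measurable_snd))

theorem measurable_sup_kernelAverage {p : ℕ → α → α → ℝ≥0∞}
    (hp : ∀ k, Measurable (Function.uncurry (p k))) {f : α → ℝ≥0∞} (hf : Measurable f) (N : ℕ) :
    Measurable fun x => (Finset.range N).sup fun j => kernelAverage μ (p j) f x := by
  induction N with
  | zero => simp
  | succ N ih =>
    simp_rw [Finset.range_add_one, Finset.sup_insert]
    exact (measurable_kernelAverage (hp N) hf).sup ih

/-- Schur's test for a symmetric sub-Markovian kernel. -/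
theorem lintegral_kernelAverage_sq_le {p : α → α → ℝ≥0∞} (hp : Measurable (Function.uncurry p))
    (hsymm : ∀ x y, p x y = p y x) (hmass : ∀ x, ∫⁻ y, p x y ∂μ ≤ 1)
    {f : α → ℝ≥0∞} (hf : Measurable f) :
    ∫⁻ x, kernelAverage μ p f x ^ 2 ∂μ ≤ ∫⁻ x, f x ^ 2 ∂μ := by
  have hpx : ∀ x, Measurable (p x) := fun x => hp.comp measurable_prodMk_left
  have hpt : ∀ x, kernelAverage μ p f x ^ 2 ≤ ∫⁻ y, p x y * f y ^ 2 ∂μ := by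
    intro x
    have hroot : ∀ a : ℝ≥0∞, (a ^ (1 / 2 : ℝ)) ^ 2 = a := by
      intro a
      rw [← ENNReal.rpow_mul_natCast]
      norm_num
    have h := lintegral_mul_sq_le (μ := μ) (f := fun y => p x y ^ (1 / 2 : ℝ))
      (g := fun y => p x y ^ (1 / 2 : ℝ) * f y) ((hpx x).pow_const _).aemeasurable
      (((hpx x).pow_const _).mul hf).aemeasurable
    simp only [← mul_assoc, ← sq, mul_pow, hroot] at h
    exact h.trans (mul_le_of_le_one_left zero_le (hmass x))
  calc ∫⁻ x, kernelAverage μ p f x ^ 2 ∂μ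
      ≤ ∫⁻ x, ∫⁻ y, p x y * f y ^ 2 ∂μ ∂μ := lintegral_mono hpt
    _ = ∫⁻ y, ∫⁻ x, p x y * f y ^ 2 ∂μ ∂μ :=
        lintegral_lintegral_swap (hp.mul ((hf.pow_const 2).comp measurable_snd)).aemeasurable
    _ ≤ ∫⁻ y, f y ^ 2 ∂μ := by
        refine lintegral_mono fun y => ?_
        simp_rw [hsymm _ y]
        rw [lintegral_mul_const _ (hpx y)]
        exact mul_le_of_le_one_left zero_le (hmass y)

/-- The maximum of finitely many kernel averages is attained at a measurably chosen index. -/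
theorem exists_measurable_argmax_kernelAverage {p : ℕ → α → α → ℝ≥0∞}
    (hp : ∀ k, Measurable (Function.uncurry (p k))) {f : α → ℝ≥0∞} (hf : Measurable f) (K : ℕ) :
    ∃ k : α → ℕ, Measurable k ∧ (∀ x, k x ≤ K) ∧
      ∀ x, (Finset.range (K + 1)).sup (fun j => kernelAverage μ (p j) f x) =
        kernelAverage μ (p (k x)) f x := by
  induction K with
  | zero => exact ⟨fun _ => 0, measurable_const, fun _ => le_rfl, fun x => by simp⟩
  | succ K ih =>
    obtain ⟨k, hk, hkK, hmax⟩ := ih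
    have hA : ∀ j, Measurable (kernelAverage μ (p j) f) :=
      fun j => measurable_kernelAverage (hp j) hf
    have hAk : Measurable fun x => kernelAverage μ (p (k x)) f x :=
      (measurable_from_prod_countable_right (f := fun z : ℕ × α => kernelAverage μ (p z.1) f z.2)
        hA).comp (hk.prodMk measurable_id)
    classical
    refine ⟨fun x => if kernelAverage μ (p (K + 1)) f x ≤ kernelAverage μ (p (k x)) f x then k x
      else K + 1, Measurable.ite (measurableSet_le (hA _) hAk) hk measurable_const, ?_, ?_⟩
    · intro x
      dsimp only
      split_ifs
      · exact (hkK x).trans (Nat.le_succ K)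
      · exact le_rfl
    · intro x
      rw [Finset.range_add_one, Finset.sup_insert, hmax x]
      dsimp only
      split_ifs with h
      · exact sup_eq_right.2 h
      · exact sup_eq_left.2 (not_le.1 h).le

/-- The `TT*` estimate for the linearised maximal operator: the square of the norm of the maximal
function of the first `K + 1` kernels is controlled by that of the first `K + 2` kernels. -/
theorem lintegral_sup_kernelAverage_sq_sq_le {p : ℕ → α → α → ℝ≥0∞}
    (hp : ∀ k, Measurable (Function.uncurry (p k))) (hsymm : ∀ k x y, p k x y = p k y x)
    {C : ℝ≥0∞}
    (hcomp : ∀ i j x z, ∫⁻ y, p i x y * p j z y ∂μ ≤ C * (p (i + 1) x z + p (j + 1) x z))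
    {f : α → ℝ≥0∞} (hf : Measurable f) (K : ℕ) {g : α → ℝ≥0∞}
    (hg : ∀ x, g x = (Finset.range (K + 1)).sup fun j => kernelAverage μ (p j) f x) :
    ((∫⁻ x, g x ^ 2 ∂μ) ^ 2) ^ 2 ≤ (∫⁻ x, f x ^ 2 ∂μ) ^ 2 * (4 * C ^ 2 * ((∫⁻ x, g x ^ 2 ∂μ) *
      ∫⁻ x, ((Finset.range (K + 2)).sup fun j => kernelAverage μ (p j) g x) ^ 2 ∂μ)) := by
  obtain ⟨k, hk, hkK, hmax⟩ := exists_measurable_argmax_kernelAverage (μ := μ) hp hf K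
  have hgk : ∀ x, g x = kernelAverage μ (p (k x)) f x := fun x => (hg x).trans (hmax x)
  have hcount : ∀ i : ℕ, Measurable fun z : α × α => p (k z.1 + i) z.1 z.2 := fun i =>
    (measurable_from_prod_countable_right
      (f := fun w : ℕ × (α × α) => p w.1 w.2.1 w.2.2) hp).comp
      (((measurable_from_nat (f := fun j => j + i)).comp
        (hk.comp measurable_fst)).prodMk measurable_id)
  have hq : Measurable fun z : α × α => p (k z.1) z.1 z.2 := hcount 0
  have hgm : Measurable g := by
    rw [funext hgk]
    exact measurable_kernelAverage (p := fun x y => p (k x) x y) hq hf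
  have hqsw : Measurable fun z : α × α => p (k z.2) z.2 z.1 := hq.comp measurable_swap
  set adj : α → ℝ≥0∞ := fun y => ∫⁻ x, p (k x) x y * g x ∂μ with hadj
  have hadjm : Measurable adj :=
    Measurable.lintegral_prod_right' (f := fun z : α × α => p (k z.2) z.2 z.1 * g z.2)
      (hqsw.mul (hgm.comp measurable_snd))
  set S : α → ℝ≥0∞ := fun x => (Finset.range (K + 2)).sup fun j => kernelAverage μ (p j) g x
    with hS
  have hSm : Measurable S :=
    measurable_sup_kernelAverage hp hgm _
  have hdual : ∫⁻ x, g x ^ 2 ∂μ = ∫⁻ y, f y * adj y ∂μ := by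
    calc ∫⁻ x, g x ^ 2 ∂μ = ∫⁻ x, ∫⁻ y, g x * (p (k x) x y * f y) ∂μ ∂μ := by
          refine lintegral_congr fun x => ?_
          have hm : Measurable fun y => p (k x) x y * f y :=
            (hq.comp measurable_prodMk_left).mul hf
          rw [lintegral_const_mul _ hm, sq]
          congr 1
          exact hgk x
      _ = ∫⁻ y, ∫⁻ x, g x * (p (k x) x y * f y) ∂μ ∂μ :=
          lintegral_lintegral_swap
            ((hgm.comp measurable_fst).mul (hq.mul (hf.comp measurable_snd))).aemeasurable
      _ = ∫⁻ y, f y * adj y ∂μ := by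
          refine lintegral_congr fun y => ?_
          have hm : Measurable fun x => p (k x) x y * g x :=
            (hqsw.comp measurable_prodMk_left).mul hgm
          rw [hadj, ← lintegral_const_mul _ hm]
          refine lintegral_congr fun x => ?_
          ring
  have hSle : ∀ x, ∫⁻ z, p (k x + 1) x z * g z ∂μ ≤ S x := fun x =>
    Finset.le_sup (f := fun j => kernelAverage μ (p j) g x)
      (Finset.mem_range.2 (Nat.succ_lt_succ (Nat.lt_succ_of_le (hkK x))))
  have hhalf : ∫⁻ x, ∫⁻ z, g x * (p (k x + 1) x z * g z) ∂μ ∂μ ≤ ∫⁻ x, g x * S x ∂μ := by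
    refine lintegral_mono fun x => ?_
    have hm : Measurable fun z => p (k x + 1) x z * g z :=
      ((hcount 1).comp measurable_prodMk_left).mul hgm
    rw [lintegral_const_mul _ hm]
    gcongr
    exact hSle x
  have hm1 : Measurable fun z : α × α => g z.1 * (p (k z.1 + 1) z.1 z.2 * g z.2) :=
    (hgm.comp measurable_fst).mul ((hcount 1).mul (hgm.comp measurable_snd))
  have hm2 : Measurable fun z : α × α => g z.2 * (p (k z.2 + 1) z.2 z.1 * g z.1) :=
    hm1.comp measurable_swap
  have hadjsq : ∫⁻ y, adj y ^ 2 ∂μ ≤ 2 * C * ∫⁻ x, g x * S x ∂μ := by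
    calc ∫⁻ y, adj y ^ 2 ∂μ
        = ∫⁻ y, ∫⁻ w : α × α, (p (k w.1) w.1 y * g w.1) * (p (k w.2) w.2 y * g w.2)
            ∂(μ.prod μ) ∂μ := by
          refine lintegral_congr fun y => ?_
          have hm : AEMeasurable (fun x => p (k x) x y * g x) μ :=
            ((hqsw.comp measurable_prodMk_left).mul hgm).aemeasurable
          rw [lintegral_prod_mul hm hm, sq]
      _ = ∫⁻ w : α × α, ∫⁻ y, (p (k w.1) w.1 y * g w.1) * (p (k w.2) w.2 y * g w.2)
            ∂μ ∂(μ.prod μ) := by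
          refine lintegral_lintegral_swap (Measurable.aemeasurable ?_)
          have h1 : Measurable fun v : α × (α × α) => p (k v.2.1) v.2.1 v.1 * g v.2.1 :=
            (hqsw.comp (measurable_fst.prodMk (measurable_fst.comp measurable_snd))).mul
              (hgm.comp (measurable_fst.comp measurable_snd))
          have h2 : Measurable fun v : α × (α × α) => p (k v.2.2) v.2.2 v.1 * g v.2.2 :=
            (hqsw.comp (measurable_fst.prodMk (measurable_snd.comp measurable_snd))).mul
              (hgm.comp (measurable_snd.comp measurable_snd))
          exact h1.mul h2
      _ ≤ ∫⁻ w : α × α, C * (g w.1 * (p (k w.1 + 1) w.1 w.2 * g w.2) +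
            g w.2 * (p (k w.2 + 1) w.2 w.1 * g w.1)) ∂(μ.prod μ) := by
          refine lintegral_mono fun w => ?_
          have hmk : ∀ x, Measurable fun y => p (k x) x y := fun x => hq.comp measurable_prodMk_left
          calc ∫⁻ y, (p (k w.1) w.1 y * g w.1) * (p (k w.2) w.2 y * g w.2) ∂μ
              = ∫⁻ y, (g w.1 * g w.2) * (p (k w.1) w.1 y * p (k w.2) w.2 y) ∂μ := by
                refine lintegral_congr fun y => ?_
                ring
            _ = (g w.1 * g w.2) * ∫⁻ y, p (k w.1) w.1 y * p (k w.2) w.2 y ∂μ :=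
                lintegral_const_mul _ ((hmk _).mul (hmk _))
            _ ≤ (g w.1 * g w.2) * (C * (p (k w.1 + 1) w.1 w.2 + p (k w.2 + 1) w.1 w.2)) := by
                gcongr
                exact hcomp _ _ _ _
            _ = _ := by
                rw [hsymm (k w.2 + 1) w.1 w.2]
                ring
      _ = C * (∫⁻ w : α × α, g w.1 * (p (k w.1 + 1) w.1 w.2 * g w.2) ∂(μ.prod μ) +
            ∫⁻ w : α × α, g w.2 * (p (k w.2 + 1) w.2 w.1 * g w.1) ∂(μ.prod μ)) := by
          rw [← lintegral_add_left hm1,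
            lintegral_const_mul _ (by fun_prop)]
      _ ≤ C * (∫⁻ x, g x * S x ∂μ + ∫⁻ x, g x * S x ∂μ) := by
          gcongr
          · rw [lintegral_prod _ hm1.aemeasurable]
            exact hhalf
          · rw [lintegral_prod_symm _ hm2.aemeasurable]
            exact hhalf
      _ = 2 * C * ∫⁻ x, g x * S x ∂μ := by ring
  have hcs1 : (∫⁻ x, g x ^ 2 ∂μ) ^ 2 ≤ (∫⁻ x, f x ^ 2 ∂μ) * ∫⁻ y, adj y ^ 2 ∂μ := by
    rw [hdual]
    exact lintegral_mul_sq_le hf.aemeasurable hadjm.aemeasurable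
  calc ((∫⁻ x, g x ^ 2 ∂μ) ^ 2) ^ 2
      ≤ ((∫⁻ x, f x ^ 2 ∂μ) * (2 * C * ∫⁻ x, g x * S x ∂μ)) ^ 2 := by
        gcongr
        exact hcs1.trans (by gcongr)
    _ = (∫⁻ x, f x ^ 2 ∂μ) ^ 2 * (4 * C ^ 2 * (∫⁻ x, g x * S x ∂μ) ^ 2) := by ring
    _ ≤ _ := by
        gcongr
        exact lintegral_mul_sq_le hgm.aemeasurable hSm.aemeasurable

/-- An `L²` maximal inequality for a sequence of symmetric sub-Markovian kernels whose compositions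
are dominated by later kernels in the sequence. -/
theorem lintegral_sup_kernelAverage_sq_le {p : ℕ → α → α → ℝ≥0∞}
    (hp : ∀ k, Measurable (Function.uncurry (p k))) (hsymm : ∀ k x y, p k x y = p k y x)
    (hmass : ∀ k x, ∫⁻ y, p k x y ∂μ ≤ 1) {C : ℝ≥0}
    (hcomp : ∀ i j x z, ∫⁻ y, p i x y * p j z y ∂μ ≤ C * (p (i + 1) x z + p (j + 1) x z))
    {f : α → ℝ≥0∞} (hf : Measurable f) (K : ℕ) :
    ∫⁻ x, ((Finset.range K).sup fun j => kernelAverage μ (p j) f x) ^ 2 ∂μ ≤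
      (12 * C ^ 2 + 2) * ∫⁻ x, f x ^ 2 ∂μ := by
  induction K generalizing f with
  | zero => simp
  | succ K ih =>
    set D : ℝ≥0∞ := 12 * C ^ 2 + 2 with hD
    have hAsq : ∀ {f : α → ℝ≥0∞}, Measurable f → ∀ j,
        ∫⁻ x, kernelAverage μ (p j) f x ^ 2 ∂μ ≤ ∫⁻ x, f x ^ 2 ∂μ :=
      fun hf j => lintegral_kernelAverage_sq_le (hp j) (hsymm j) (hmass j) hf
    have hSm : ∀ {f : α → ℝ≥0∞}, Measurable f → ∀ N, Measurable fun x =>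
        (Finset.range N).sup fun j => kernelAverage μ (p j) f x :=
      fun hf N => measurable_sup_kernelAverage hp hf N
    have hstep : ∀ {f : α → ℝ≥0∞}, Measurable f → ∀ N,
        ∫⁻ x, ((Finset.range (N + 1)).sup fun j => kernelAverage μ (p j) f x) ^ 2 ∂μ ≤
          ∫⁻ x, ((Finset.range N).sup fun j => kernelAverage μ (p j) f x) ^ 2 ∂μ +
            ∫⁻ x, f x ^ 2 ∂μ := by
      intro f hf N
      calc ∫⁻ x, ((Finset.range (N + 1)).sup fun j => kernelAverage μ (p j) f x) ^ 2 ∂μ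
          ≤ ∫⁻ x, (((Finset.range N).sup fun j => kernelAverage μ (p j) f x) ^ 2 +
              kernelAverage μ (p N) f x ^ 2) ∂μ := by
            refine lintegral_mono fun x => ?_
            rw [Finset.range_add_one, Finset.sup_insert]
            rcases le_total (kernelAverage μ (p N) f x)
              ((Finset.range N).sup fun j => kernelAverage μ (p j) f x) with h | h
            · rw [sup_eq_right.2 h]
              exact le_self_add
            · rw [sup_eq_left.2 h]
              exact le_add_self
        _ ≤ _ := by
            rw [lintegral_add_left ((hSm hf N).pow_const 2)]
            exact add_le_add le_rfl (hAsq hf N)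
    rcases eq_or_ne (∫⁻ x, f x ^ 2 ∂μ) ⊤ with htop | htop
    · rw [htop, ENNReal.mul_top (by simp [hD])]
      exact le_top
    set g : α → ℝ≥0∞ := fun x => (Finset.range (K + 1)).sup fun j => kernelAverage μ (p j) f x
      with hg
    have hgm : Measurable g := hSm hf _
    have hgK : ∫⁻ x, g x ^ 2 ∂μ ≤ (D + 1) * ∫⁻ x, f x ^ 2 ∂μ :=
      (hstep hf K).trans (by rw [add_mul, one_mul]; gcongr; exact ih hf)
    have hDtop : D ≠ ⊤ := by
      simp only [hD]
      finiteness
    have hgtop : ∫⁻ x, g x ^ 2 ∂μ ≠ ⊤ :=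
      ne_top_of_le_ne_top (ENNReal.mul_ne_top (by finiteness) htop) hgK
    have hnext : ∫⁻ x, ((Finset.range (K + 2)).sup fun j => kernelAverage μ (p j) g x) ^ 2 ∂μ ≤
        (D + 2) * ∫⁻ x, g x ^ 2 ∂μ := by
      refine (hstep hgm (K + 1)).trans ?_
      calc _ ≤ (D * ∫⁻ x, g x ^ 2 ∂μ + ∫⁻ x, g x ^ 2 ∂μ) + ∫⁻ x, g x ^ 2 ∂μ := by
            gcongr
            refine (hstep hgm K).trans ?_
            gcongr
            exact ih hgm
        _ = _ := by ring
    have hmain := lintegral_sup_kernelAverage_sq_sq_le hp hsymm hcomp hf K (g := g) fun x => rfl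
    set F : ℝ≥0∞ := ∫⁻ x, f x ^ 2 ∂μ
    set G : ℝ≥0∞ := ∫⁻ x, g x ^ 2 ∂μ
    have hquad : G ^ 2 * G ^ 2 ≤ (D * F) ^ 2 * G ^ 2 := by
      calc G ^ 2 * G ^ 2 = (G ^ 2) ^ 2 := by ring
        _ ≤ F ^ 2 * (4 * C ^ 2 * (G * ((D + 2) * G))) := hmain.trans (by gcongr)
        _ = (4 * C ^ 2 * (D + 2)) * (F ^ 2 * G ^ 2) := by ring
        _ ≤ D ^ 2 * (F ^ 2 * G ^ 2) := by
            gcongr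
            calc 4 * (C : ℝ≥0∞) ^ 2 * (D + 2) ≤ 4 * (C : ℝ≥0∞) ^ 2 * (D + 2) +
                  (96 * (C : ℝ≥0∞) ^ 4 + 32 * (C : ℝ≥0∞) ^ 2 + 4) := le_self_add
              _ = D ^ 2 := by
                  rw [hD]
                  ring
        _ = (D * F) ^ 2 * G ^ 2 := by ring
    rcases eq_or_ne G 0 with h0 | h0
    · rw [h0]
      exact zero_le
    · have h := (ENNReal.mul_le_mul_iff_left (pow_ne_zero 2 h0) (ENNReal.pow_ne_top hgtop)).1 hquad
      exact (ENNReal.pow_le_pow_left_iff two_ne_zero).1 h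

/-- The maximal inequality over the whole sequence of kernels. -/
theorem lintegral_iSup_kernelAverage_sq_le {p : ℕ → α → α → ℝ≥0∞}
    (hp : ∀ k, Measurable (Function.uncurry (p k))) (hsymm : ∀ k x y, p k x y = p k y x)
    (hmass : ∀ k x, ∫⁻ y, p k x y ∂μ ≤ 1) {C : ℝ≥0}
    (hcomp : ∀ i j x z, ∫⁻ y, p i x y * p j z y ∂μ ≤ C * (p (i + 1) x z + p (j + 1) x z))
    {f : α → ℝ≥0∞} (hf : Measurable f) :
    ∫⁻ x, (⨆ j, kernelAverage μ (p j) f x) ^ 2 ∂μ ≤ (12 * C ^ 2 + 2) * ∫⁻ x, f x ^ 2 ∂μ := by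
  have hpow : ∀ x, (⨆ j, kernelAverage μ (p j) f x) ^ 2 =
      ⨆ N, ((Finset.range N).sup fun j => kernelAverage μ (p j) f x) ^ 2 := by
    intro x
    rw [← ENNReal.iSup_pow]
    congr 1
    refine le_antisymm (iSup_le fun j => ?_) (iSup_le fun N => Finset.sup_le fun j _ => ?_)
    · exact le_iSup_of_le (j + 1) (Finset.le_sup (f := fun j => kernelAverage μ (p j) f x)
        (Finset.self_mem_range_succ j))
    · exact le_iSup (fun j => kernelAverage μ (p j) f x) j
  simp_rw [hpow]
  rw [lintegral_iSup]
  · exact iSup_le fun N => lintegral_sup_kernelAverage_sq_le hp hsymm hmass hcomp hf N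
  · exact fun N => (measurable_sup_kernelAverage hp hf N).pow_const 2
  · intro N N' hN x
    dsimp only
    gcongr

end PositiveKernels

section HeatKernel

variable {E : Type*} [NormedAddCommGroup E] [InnerProductSpace ℝ E]

/-- The Gaussian kernel with Fourier transform `exp (-π s ‖ξ‖²)`. -/
noncomputable def heatKernel (s : ℝ) (x : E) : ℝ≥0∞ :=
  ENNReal.ofReal (s ^ (-(Module.finrank ℝ E / 2 : ℝ)) * Real.exp (-π * ‖x‖ ^ 2 / s))

theorem heatKernel_neg (s : ℝ) (x : E) : heatKernel s (-x) = heatKernel s x := by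
  simp [heatKernel]

/-- Comparison of Gaussian kernels at comparable scales. -/
theorem heatKernel_le {s u : ℝ} (hs : 0 < s) (hsu : s ≤ u) (hus : u ≤ 2 * s) (x : E) :
    heatKernel s x ≤ ((2 ^ (Module.finrank ℝ E / 2 : ℝ) : ℝ≥0) : ℝ≥0∞) * heatKernel u x := by
  set d : ℝ := Module.finrank ℝ E / 2 with hd
  have hd0 : 0 ≤ d := by positivity
  have hu : 0 < u := hs.trans_le hsu
  have h2 : ((2 ^ d : ℝ≥0) : ℝ≥0∞) = ENNReal.ofReal (2 ^ d) := by
    rw [ENNReal.ofReal, Real.toNNReal_rpow_of_nonneg (by norm_num)]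
    norm_num
  rw [heatKernel, heatKernel, h2, ← ENNReal.ofReal_mul (by positivity), ← hd]
  refine ENNReal.ofReal_le_ofReal ?_
  rw [← mul_assoc]
  have h1 : s ^ (-d) ≤ 2 ^ d * u ^ (-d) := by
    rw [Real.rpow_neg hs.le, Real.rpow_neg hu.le, ← div_eq_mul_inv, inv_eq_one_div,
      div_le_div_iff₀ (by positivity) (by positivity), one_mul, ← Real.mul_rpow (by norm_num) hs.le]
    exact Real.rpow_le_rpow hu.le hus hd0
  have h3 : -π * ‖x‖ ^ 2 / s ≤ -π * ‖x‖ ^ 2 / u := by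
    rw [div_le_div_iff₀ hs hu]
    have : 0 ≤ π * ‖x‖ ^ 2 := by positivity
    nlinarith
  gcongr

/-- Completing the square in a product of two Gaussian kernels. -/
theorem heatKernel_mul_heatKernel {s r : ℝ} (hs : 0 < s) (hr : 0 < r) (x y z : E) :
    heatKernel s (x - y) * heatKernel r (z - y) = heatKernel (s + r) (x - z) *
      heatKernel (s * r / (s + r)) ((s + r)⁻¹ • (r • x + s • z) - y) := by
  have hsr : 0 < s + r := by positivity
  have hnorm : -π * ‖x - y‖ ^ 2 / s + -π * ‖z - y‖ ^ 2 / r = -π * ‖x - z‖ ^ 2 / (s + r) +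
      -π * ‖(s + r)⁻¹ • (r • x + s • z) - y‖ ^ 2 / (s * r / (s + r)) := by
    have e1 : x - z = (x - y) - (z - y) := by abel
    have e2 : (s + r)⁻¹ • (r • x + s • z) - y = (s + r)⁻¹ • (r • (x - y) + s • (z - y)) := by
      have : y = (s + r)⁻¹ • ((s + r) • y) := by rw [inv_smul_smul₀ hsr.ne']
      conv_lhs => rw [this]
      rw [← smul_sub]
      congr 1
      simp only [smul_sub, add_smul]
      abel
    rw [e1, e2, norm_smul, norm_sub_sq_real (x - y), mul_pow, norm_add_sq_real, norm_smul,
      norm_smul,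
      real_inner_smul_left, real_inner_smul_right, norm_inv, Real.norm_of_nonneg hs.le,
      Real.norm_of_nonneg hr.le, Real.norm_of_nonneg hsr.le]
    field_simp
    ring
  simp only [heatKernel]
  rw [← ENNReal.ofReal_mul (by positivity), ← ENNReal.ofReal_mul (by positivity)]
  congr 1
  rw [mul_mul_mul_comm, mul_mul_mul_comm ((s + r) ^ _), ← Real.exp_add, ← Real.exp_add, hnorm,
    ← Real.mul_rpow hs.le hr.le, ← Real.mul_rpow hsr.le (by positivity)]
  have hprod : (s + r) * (s * r / (s + r)) = s * r := by field_simp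
  rw [hprod]

variable [MeasurableSpace E] [BorelSpace E]

theorem measurable_heatKernel (s : ℝ) : Measurable (heatKernel s : E → ℝ≥0∞) := by
  unfold heatKernel
  fun_prop

variable [FiniteDimensional ℝ E]

theorem lintegral_heatKernel {s : ℝ} (hs : 0 < s) (x : E) : ∫⁻ y : E, heatKernel s (x - y) = 1 := by
  rw [lintegral_sub_left_eq_self (heatKernel s) x]
  have hb : 0 < π / s := by positivity
  have hgauss := GaussianFourier.integral_rexp_neg_mul_sq_norm (V := E) hb
  have hval : π / (π / s) = s := by field_simp
  rw [hval] at hgauss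
  have hexp : ∀ v : E, -π * ‖v‖ ^ 2 / s = -(π / s) * ‖v‖ ^ 2 := fun v => by ring
  have hI : Integrable fun v : E => Real.exp (-(π / s) * ‖v‖ ^ 2) := by
    by_contra h
    rw [integral_undef h] at hgauss
    exact (Real.rpow_pos_of_pos hs _).ne hgauss
  simp only [heatKernel, hexp]
  rw [← ofReal_integral_eq_lintegral_ofReal (hI.const_mul _)
    (Filter.Eventually.of_forall fun v => by positivity), integral_const_mul, hgauss,
    Real.rpow_neg hs.le, inv_mul_cancel₀ (by positivity), ENNReal.ofReal_one]

theorem lintegral_heatKernel_mul_heatKernel {s r : ℝ} (hs : 0 < s) (hr : 0 < r) (x z : E) :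
    ∫⁻ y, heatKernel s (x - y) * heatKernel r (z - y) = heatKernel (s + r) (x - z) := by
  simp_rw [heatKernel_mul_heatKernel hs hr]
  rw [lintegral_const_mul' _ _ (by simp [heatKernel]), lintegral_heatKernel (by positivity),
    mul_one]

/-- The average of `f` against the Gaussian kernel at scale `s`. -/
noncomputable def heatAverage (s : ℝ) (f : E → ℝ≥0∞) (x : E) : ℝ≥0∞ :=
  kernelAverage volume (fun x y => heatKernel s (x - y)) f x

/-- The dyadic maximal function of the heat semigroup. -/
noncomputable def heatMaximal (f : E → ℝ≥0∞) (x : E) : ℝ≥0∞ :=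
  ⨆ m : ℕ, ⨆ k : ℕ, heatAverage (2 ^ ((k : ℤ) - m)) f x

theorem measurable_uncurry_heatKernel_sub (s : ℝ) :
    Measurable (Function.uncurry fun x y : E => heatKernel s (x - y)) :=
  (measurable_heatKernel s).comp (measurable_fst.sub measurable_snd)

theorem measurable_heatAverage (s : ℝ) {f : E → ℝ≥0∞} (hf : Measurable f) :
    Measurable (heatAverage s f) :=
  measurable_kernelAverage (measurable_uncurry_heatKernel_sub s) hf

theorem measurable_heatMaximal {f : E → ℝ≥0∞} (hf : Measurable f) : Measurable (heatMaximal f) :=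
  Measurable.iSup fun _ => Measurable.iSup fun _ => measurable_heatAverage _ hf

theorem heatAverage_le_heatMaximal {s : ℝ} (hs : 0 < s) (f : E → ℝ≥0∞) (x : E) :
    heatAverage s f x ≤
      ((2 ^ (Module.finrank ℝ E / 2 : ℝ) : ℝ≥0) : ℝ≥0∞) * heatMaximal f x := by
  obtain ⟨n, hn, hn'⟩ := exists_mem_Ico_zpow hs (one_lt_two (α := ℝ))
  have hidx : ((n + 1).toNat : ℤ) - ((-(n + 1)).toNat : ℤ) = n + 1 := by omega
  have hle : heatAverage (2 ^ (n + 1)) f x ≤ heatMaximal f x := by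
    rw [← hidx]
    exact le_iSup_of_le _ (le_iSup_of_le (n + 1).toNat le_rfl)
  refine le_trans ?_ (mul_le_mul_right hle _)
  simp only [heatAverage, kernelAverage]
  rw [← lintegral_const_mul' _ _ ENNReal.coe_ne_top]
  refine lintegral_mono fun y => ?_
  rw [← mul_assoc]
  gcongr
  refine heatKernel_le hs hn'.le ?_ _
  rw [zpow_add_one₀ two_ne_zero, mul_comm]
  gcongr

/-- The maximal function of the heat semigroup is bounded on `L²`. -/
theorem lintegral_heatMaximal_sq_le {f : E → ℝ≥0∞} (hf : Measurable f) :
    ∫⁻ x, heatMaximal f x ^ 2 ≤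
      (12 * ((2 ^ (Module.finrank ℝ E / 2 : ℝ) : ℝ≥0) : ℝ≥0∞) ^ 2 + 2) * ∫⁻ x, f x ^ 2 := by
  simp_rw [heatMaximal, ENNReal.iSup_pow]
  have hpos : ∀ j : ℤ, (0 : ℝ) < 2 ^ j := fun j => by positivity
  rw [lintegral_iSup]
  · refine iSup_le fun m => ?_
    refine (lintegral_mono fun x => (ENNReal.iSup_pow _ 2).ge).trans ?_
    refine lintegral_iSup_kernelAverage_sq_le
      (p := fun k x y => heatKernel (2 ^ ((k : ℤ) - m)) (x - y))
      (fun k => measurable_uncurry_heatKernel_sub _) ?_ ?_ ?_ hf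
    · intro k x y
      rw [← heatKernel_neg, neg_sub]
    · exact fun k x => (lintegral_heatKernel (hpos _) x).le
    · intro i j x z
      rw [lintegral_heatKernel_mul_heatKernel (hpos _) (hpos _)]
      have hdouble : ∀ i : ℕ, (2 : ℝ) ^ (((i + 1 : ℕ) : ℤ) - m) = 2 * 2 ^ ((i : ℤ) - m) := by
        intro i
        rw [Nat.cast_succ, add_sub_right_comm, zpow_add_one₀ two_ne_zero, mul_comm]
      have hi := hpos ((i : ℤ) - m)
      have hj := hpos ((j : ℤ) - m)
      rcases le_total ((2 : ℝ) ^ ((i : ℤ) - m)) (2 ^ ((j : ℤ) - m)) with h | h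
      · refine (heatKernel_le (u := 2 ^ (((j + 1 : ℕ) : ℤ) - m)) (by positivity) ?_ ?_ _).trans ?_
        · rw [hdouble]; linarith
        · rw [hdouble]; linarith
        · gcongr
          exact le_add_self
      · refine (heatKernel_le (u := 2 ^ (((i + 1 : ℕ) : ℤ) - m)) (by positivity) ?_ ?_ _).trans ?_
        · rw [hdouble]; linarith
        · rw [hdouble]; linarith
        · gcongr
          exact le_self_add
  · exact fun m => Measurable.iSup fun k => (measurable_heatAverage _ hf).pow_const 2
  · intro m m' hm x
    refine iSup_le fun k => le_iSup_of_le (k + (m' - m)) (le_of_eq ?_)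
    congr 3
    omega

/-- The Gaussian Fourier multiplier is dominated by the heat average. -/
theorem enorm_integral_gaussian_mul_fourier_le {f : E → ℂ} (hf : Integrable f) {s : ℝ} (hs : 0 < s)
    (x : E) :
    ‖∫ ξ, (Real.exp (-π * s * ‖ξ‖ ^ 2) : ℂ) * 𝓕 f ξ *
      Complex.exp (2 * π * Complex.I * (⟪x, ξ⟫ : ℝ))‖ₑ ≤ heatAverage s (fun y => ‖f y‖ₑ) x := by
  have hb : 0 < ((π * s : ℝ) : ℂ).re := by
    rw [Complex.ofReal_re]
    positivity
  have hφ := GaussianFourier.integrable_cexp_neg_mul_sq_norm_add hb (2 * π * Complex.I) x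
  have hswap : ∫ ξ, 𝓕 f ξ • Complex.exp (-((π * s : ℝ) : ℂ) * ‖ξ‖ ^ 2 +
        2 * π * Complex.I * (⟪x, ξ⟫ : ℝ)) =
      ∫ y, f y • 𝓕 (fun v : E => Complex.exp (-((π * s : ℝ) : ℂ) * ‖v‖ ^ 2 +
        2 * π * Complex.I * (⟪x, v⟫ : ℝ))) y := by
    simpa using! VectorFourier.integral_fourierIntegral_smul_eq_flip (L := innerₗ E)
      Real.continuous_fourierChar continuous_inner hf hφ
  have hlhs : ∫ ξ, (Real.exp (-π * s * ‖ξ‖ ^ 2) : ℂ) * 𝓕 f ξ *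
      Complex.exp (2 * π * Complex.I * (⟪x, ξ⟫ : ℝ)) =
      ∫ ξ, 𝓕 f ξ • Complex.exp (-((π * s : ℝ) : ℂ) * ‖ξ‖ ^ 2 +
        2 * π * Complex.I * (⟪x, ξ⟫ : ℝ)) := by
    refine integral_congr_ae (Filter.Eventually.of_forall fun ξ => ?_)
    simp only [smul_eq_mul, Complex.exp_add]
    push_cast
    rw [neg_mul]
    ring
  rw [hlhs, hswap]
  refine (enorm_integral_le_lintegral_enorm _).trans (le_of_eq (lintegral_congr fun y => ?_))
  have hK : heatKernel s (x - y) = ‖𝓕 (fun v : E => Complex.exp (-((π * s : ℝ) : ℂ) * ‖v‖ ^ 2 +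
        2 * π * Complex.I * (⟪x, v⟫ : ℝ))) y‖ₑ := by
    rw [fourier_gaussian_innerProductSpace' hb]
    have h1 : ((π : ℂ) / ((π * s : ℝ) : ℂ)) ^ (Module.finrank ℝ E / 2 : ℂ) =
        ((s ^ (-(Module.finrank ℝ E / 2 : ℝ)) : ℝ) : ℂ) := by
      have : (π : ℂ) / ((π * s : ℝ) : ℂ) = ((s⁻¹ : ℝ) : ℂ) := by
        rw [← Complex.ofReal_div]
        congr 1
        field_simp
      rw [this, Real.rpow_neg hs.le, ← Real.inv_rpow hs.le, Complex.ofReal_cpow (by positivity)]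
      push_cast
      rfl
    have h2 : Complex.exp (-(π : ℂ) ^ 2 * ‖x - y‖ ^ 2 / ((π * s : ℝ) : ℂ)) =
        ((Real.exp (-π * ‖x - y‖ ^ 2 / s) : ℝ) : ℂ) := by
      rw [Complex.ofReal_exp]
      congr 1
      push_cast
      have : (s : ℂ) ≠ 0 := by exact_mod_cast hs.ne'
      have : (π : ℂ) ≠ 0 := by exact_mod_cast Real.pi_ne_zero
      field_simp
    rw [h1, h2, ← Complex.ofReal_mul, heatKernel, ← ofReal_norm, Complex.norm_real,
      Real.norm_of_nonneg (by positivity)]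
  rw [enorm_smul, ← hK, mul_comm]

end HeatKernel

section Profile

theorem measurable_pPow (γ : ℝ) : Measurable fun x => pPow x γ := by
  unfold pPow
  exact Measurable.ite measurableSet_Ioi (measurable_id.pow_const γ) measurable_const

/-- The difference of the Bochner–Riesz and the Gaussian symbols at frequency radius `a` and
scale `t`. -/
noncomputable def symbolDiff (δ a t : ℝ) : ℝ :=
  pPow (1 - a ^ 2 / t ^ 2) δ - Real.exp (-π * (t ^ 2)⁻¹ * a ^ 2)

theorem Measurable.symbolDiff {α : Type*} [MeasurableSpace α] (δ : ℝ) {u v : α → ℝ}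
    (hu : Measurable u) (hv : Measurable v) : Measurable fun p => symbolDiff δ (u p) (v p) := by
  have h1 : Measurable fun p => 1 - u p ^ 2 / v p ^ 2 := by fun_prop
  have h2 : Measurable fun p => Real.exp (-π * (v p ^ 2)⁻¹ * u p ^ 2) := by fun_prop
  exact ((measurable_pPow δ).comp h1).sub h2

theorem symbolDiff_zero_left (δ t : ℝ) : symbolDiff δ 0 t = 0 := by
  simp [symbolDiff, pPow]

theorem symbolDiff_eq_one_left (δ a t : ℝ) :
    symbolDiff δ a t = symbolDiff δ 1 (a⁻¹ * t) := by
  have hquot : a ^ 2 / t ^ 2 = 1 ^ 2 / (a⁻¹ * t) ^ 2 := by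
    rw [mul_pow, inv_pow, one_pow, one_div, mul_inv, inv_inv, div_eq_mul_inv]
  have hexp : -π * (t ^ 2)⁻¹ * a ^ 2 = -π * ((a⁻¹ * t) ^ 2)⁻¹ * 1 ^ 2 := by
    rw [mul_pow, mul_inv, inv_pow, inv_inv]
    ring
  rw [symbolDiff, symbolDiff, hquot, hexp]

/-- Vanishing of the symbol difference at the origin of frequency space. -/
theorem exists_abs_symbolDiff_one_le (δ : ℝ) :
    ∃ c V : ℝ, 1 ≤ V ∧ ∀ t, V < t → |symbolDiff δ 1 t| ≤ c * t⁻¹ := by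
  have hd : DifferentiableAt ℝ (fun u : ℝ => (1 - u) ^ δ - Real.exp (-π * u)) 0 := by
    refine DifferentiableAt.sub (DifferentiableAt.rpow_const (by fun_prop) (by simp)) (by fun_prop)
  obtain ⟨c, hc⟩ := hd.isBigO_sub.bound
  obtain ⟨ε, hε, hball⟩ := Metric.eventually_nhds_iff.1 hc
  refine ⟨|c|, max 1 ε⁻¹, le_max_left _ _, fun t ht => ?_⟩
  have ht1 : 1 < t := (le_max_left _ _).trans_lt ht
  have ht0 : 0 < t := by linarith
  have hsq : (t ^ 2)⁻¹ ≤ t⁻¹ := by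
    gcongr
    nlinarith
  have hεt : t⁻¹ < ε := inv_lt_of_inv_lt₀ hε ((le_max_right _ _).trans_lt ht)
  have h := hball (y := (t ^ 2)⁻¹) (by
    rw [dist_zero_right, Real.norm_of_nonneg (by positivity)]
    exact hsq.trans_lt hεt)
  have hlt : (t ^ 2)⁻¹ < 1 := inv_lt_one_of_one_lt₀ (by nlinarith)
  have hs : symbolDiff δ 1 t = (1 - (t ^ 2)⁻¹) ^ δ - Real.exp (-π * (t ^ 2)⁻¹) := by
    simp [symbolDiff, pPow, hlt]
  simp only [sub_zero, Real.one_rpow, mul_zero, Real.exp_zero, sub_self] at h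
  rw [hs, ← Real.norm_eq_abs]
  refine h.trans ?_
  rw [Real.norm_of_nonneg (by positivity : 0 ≤ (t ^ 2)⁻¹)]
  gcongr
  exact le_abs_self c

theorem integrableOn_symbolDiff_one {δ : ℝ} (hδ : -(1 / 2) < δ) :
    IntegrableOn (fun t => t⁻¹ * symbolDiff δ 1 t ^ 2) (Set.Ioi 0) := by
  obtain ⟨c, V, hV, hc⟩ := exists_abs_symbolDiff_one_le δ
  have hmeas : Measurable fun t => t⁻¹ * symbolDiff δ 1 t ^ 2 :=
    measurable_inv.mul ((Measurable.symbolDiff δ measurable_const measurable_id).pow_const 2)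
  have hsplit : Set.Ioi (0 : ℝ) = Set.Ioc 0 1 ∪ (Set.Ioc 1 V ∪ Set.Ioi V) := by
    rw [Set.Ioc_union_Ioi_eq_Ioi hV, Set.Ioc_union_Ioi_eq_Ioi zero_le_one]
  rw [hsplit]
  refine IntegrableOn.union ?_ (IntegrableOn.union ?_ ?_)
  · refine Integrable.mono' (g := fun _ => (1 : ℝ)) (integrable_const _)
      hmeas.aestronglyMeasurable ((ae_restrict_iff' measurableSet_Ioc).2
      (Filter.Eventually.of_forall fun t ht => ?_))
    have ht0 : 0 < t := ht.1
    have hnot : ¬ (t ^ 2)⁻¹ < 1 := not_lt.2 ((one_le_inv₀ (by positivity)).2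
      (pow_le_one₀ ht0.le ht.2))
    have hs : symbolDiff δ 1 t = -Real.exp (-π * (t ^ 2)⁻¹) := by
      simp [symbolDiff, pPow, hnot]
    have hexp : Real.exp (-π * (t ^ 2)⁻¹) ≤ t := by
      rw [neg_mul, Real.exp_neg]
      refine inv_le_of_inv_le₀ ht0 ?_
      have h1 : t⁻¹ ≤ (t ^ 2)⁻¹ := by
        gcongr
        nlinarith [ht.2]
      have h2 : (t ^ 2)⁻¹ ≤ π * (t ^ 2)⁻¹ :=
        le_mul_of_one_le_left (by positivity) (by linarith [Real.pi_gt_three])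
      linarith [Real.add_one_le_exp (π * (t ^ 2)⁻¹)]
    rw [Real.norm_of_nonneg (by positivity), hs, neg_sq, inv_mul_le_iff₀ ht0, mul_one]
    calc Real.exp (-π * (t ^ 2)⁻¹) ^ 2 ≤ t ^ 2 := by gcongr
      _ ≤ t := by nlinarith [ht.2]
  · have hpow : IntegrableOn (fun t : ℝ => (t - 1) ^ (2 * δ)) (Set.Ioc 1 V) := by
      have h := (intervalIntegral.intervalIntegrable_rpow' (a := 0) (b := V - 1)
        (show -1 < 2 * δ by linarith)).comp_sub_right 1
      rw [zero_add, sub_add_cancel] at h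
      exact (intervalIntegrable_iff_integrableOn_Ioc_of_le hV).1 h
    refine Integrable.mono'
      (g := fun t => 2 * (1 + (t - 1) ^ (2 * δ) / (V ^ 2) ^ (2 * δ)) + 2) ?_
      hmeas.aestronglyMeasurable ((ae_restrict_iff' measurableSet_Ioc).2
      (Filter.Eventually.of_forall fun t ht => ?_))
    · exact (((integrable_const _).add (hpow.div_const _)).const_mul 2).add (integrable_const _)
    · have ht1 : 1 < t := ht.1
      have ht0 : 0 < t := by linarith
      have hlt : (t ^ 2)⁻¹ < 1 := inv_lt_one_of_one_lt₀ (by nlinarith)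
      have hs : symbolDiff δ 1 t = (1 - (t ^ 2)⁻¹) ^ δ - Real.exp (-π * (t ^ 2)⁻¹) := by
        simp [symbolDiff, pPow, hlt]
      have hx0 : 0 < 1 - (t ^ 2)⁻¹ := by linarith
      have hx1 : 1 - (t ^ 2)⁻¹ ≤ 1 := by
        have : 0 < (t ^ 2)⁻¹ := by positivity
        linarith
      have hlow : (t - 1) / V ^ 2 ≤ 1 - (t ^ 2)⁻¹ := by
        calc (t - 1) / V ^ 2 ≤ (t - 1) / t ^ 2 := by
              gcongr
              exact ht.2
          _ ≤ (t ^ 2 - 1) / t ^ 2 := by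
              gcongr
              nlinarith
          _ = 1 - (t ^ 2)⁻¹ := by field_simp
      have hsing : ((1 - (t ^ 2)⁻¹) ^ δ) ^ 2 ≤ 1 + (t - 1) ^ (2 * δ) / (V ^ 2) ^ (2 * δ) := by
        have hnn : 0 ≤ (t - 1) ^ (2 * δ) / (V ^ 2) ^ (2 * δ) := by
          have : 0 ≤ t - 1 := by linarith
          positivity
        rw [← Real.rpow_mul_natCast hx0.le, mul_comm δ, Nat.cast_ofNat]
        rcases le_total 0 δ with h | h
        · have := Real.rpow_le_one hx0.le hx1 (by positivity : 0 ≤ 2 * δ)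
          linarith
        · rw [← Real.div_rpow (by linarith) (by positivity)] at hnn ⊢
          have := Real.rpow_le_rpow_of_nonpos (div_pos (by linarith) (by positivity)) hlow
            (by linarith : 2 * δ ≤ 0)
          linarith
      have hexp : Real.exp (-π * (t ^ 2)⁻¹) ≤ 1 := Real.exp_le_one_iff.2 (by
        have : 0 ≤ π * (t ^ 2)⁻¹ := by positivity
        linarith)
      have hexp0 : 0 ≤ Real.exp (-π * (t ^ 2)⁻¹) := (Real.exp_pos _).le
      rw [Real.norm_of_nonneg (by positivity), hs]
      calc t⁻¹ * ((1 - (t ^ 2)⁻¹) ^ δ - Real.exp (-π * (t ^ 2)⁻¹)) ^ 2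
          ≤ 1 * ((1 - (t ^ 2)⁻¹) ^ δ - Real.exp (-π * (t ^ 2)⁻¹)) ^ 2 := by
            gcongr
            exact inv_le_one_of_one_le₀ ht1.le
        _ ≤ 2 * ((1 - (t ^ 2)⁻¹) ^ δ) ^ 2 + 2 := by
            nlinarith [sq_nonneg ((1 - (t ^ 2)⁻¹) ^ δ + Real.exp (-π * (t ^ 2)⁻¹))]
        _ ≤ _ := by linarith
  · have hV0 : 0 < V := by linarith
    refine Integrable.mono' (g := fun t => c ^ 2 * t ^ (-2 : ℝ))
      ((integrableOn_Ioi_rpow_of_lt (by norm_num) hV0).const_mul _)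
      hmeas.aestronglyMeasurable ((ae_restrict_iff' measurableSet_Ioi).2
      (Filter.Eventually.of_forall fun t ht => ?_))
    have ht1 : 1 ≤ t := hV.trans (Set.mem_Ioi.1 ht).le
    have ht0 : 0 < t := by linarith
    rw [Real.norm_of_nonneg (by positivity), Real.rpow_neg ht0.le, Real.rpow_ofNat, ← inv_pow,
      ← mul_pow, ← sq_abs (symbolDiff δ 1 t)]
    calc t⁻¹ * |symbolDiff δ 1 t| ^ 2 ≤ 1 * |symbolDiff δ 1 t| ^ 2 := by
          gcongr
          exact inv_le_one_of_one_le₀ ht1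
      _ ≤ (c * t⁻¹) ^ 2 := by
          rw [one_mul]
          gcongr
          exact hc t ht

/-- The square function bound for the symbol difference, uniformly over frequencies. -/
theorem exists_lintegral_symbolDiff_le {δ : ℝ} (hδ : -(1 / 2) < δ) :
    ∃ C : ℝ≥0, ∀ a, 0 ≤ a →
      ∫⁻ t in Set.Ioi (0 : ℝ), ENNReal.ofReal (t⁻¹ * symbolDiff δ a t ^ 2) ≤ C := by
  set H : ℝ → ℝ≥0∞ := fun t => ENNReal.ofReal (t⁻¹ * symbolDiff δ 1 t ^ 2) with hH
  have hfin : ∫⁻ t in Set.Ioi (0 : ℝ), H t ≠ ⊤ := by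
    refine ne_top_of_le_ne_top (integrableOn_symbolDiff_one hδ).2.ne (lintegral_mono fun t => ?_)
    rw [hH, ← ofReal_norm]
    exact ENNReal.ofReal_le_ofReal (Real.le_norm_self _)
  refine ⟨(∫⁻ t in Set.Ioi (0 : ℝ), H t).toNNReal, fun a ha => ?_⟩
  rw [ENNReal.coe_toNNReal hfin]
  rcases ha.eq_or_lt with rfl | ha
  · simp [symbolDiff_zero_left]
  have hscale : ∀ t, ENNReal.ofReal (t⁻¹ * symbolDiff δ a t ^ 2) =
      ENNReal.ofReal a⁻¹ * H (a⁻¹ * t) := by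
    intro t
    rw [hH, ← ENNReal.ofReal_mul (by positivity), symbolDiff_eq_one_left δ a t]
    congr 1
    rw [mul_inv, inv_inv, ← mul_assoc, ← mul_assoc, inv_mul_cancel₀ ha.ne', one_mul]
  simp_rw [hscale]
  rw [lintegral_const_mul' _ _ ENNReal.ofReal_ne_top]
  have hind : ∀ t, (Set.Ioi (0 : ℝ)).indicator (fun t => H (a⁻¹ * t)) t =
      (Set.Ioi (0 : ℝ)).indicator H (a⁻¹ * t) := by
    intro t
    simp only [Set.indicator, Set.mem_Ioi]
    congr 1
    simp [ha]
  rw [← lintegral_indicator measurableSet_Ioi, ← lintegral_indicator measurableSet_Ioi,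
    lintegral_congr hind]
  have hcov : ENNReal.ofReal a⁻¹ * ∫⁻ t, (Set.Ioi (0 : ℝ)).indicator H (a⁻¹ * t) =
      ∫⁻ t, (Set.Ioi (0 : ℝ)).indicator H t := by
    conv_rhs => rw [← Real.smul_map_volume_mul_left (inv_ne_zero ha.ne')]
    rw [lintegral_smul_measure, abs_of_pos (inv_pos.2 ha), smul_eq_mul,
      (measurableEmbedding_mulLeft₀ (inv_ne_zero ha.ne')).lintegral_map]
  exact hcov.le

end Profile

section BochnerRiesz

variable {E : Type*} [NormedAddCommGroup E] [InnerProductSpace ℝ E] [FiniteDimensional ℝ E]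
  [MeasurableSpace E] [BorelSpace E]

theorem lintegral_enorm_fourier_schwartz_sq (f : SchwartzMap E ℂ) :
    ∫⁻ ξ, ‖𝓕 (⇑f) ξ‖ₑ ^ 2 = ∫⁻ x, ‖f x‖ₑ ^ 2 := by
  rw [← SchwartzMap.fourier_coe, ← lintegral_enorm_fourierInv_sq (𝓕 f).integrable ((𝓕 f).memLp 2),
    ← SchwartzMap.fourierInv_coe, FourierTransform.fourierInv_fourier_eq]

/-- The Fourier multiplier operator with symbol `m ‖ξ‖`, written as an integral. -/
noncomputable def radialMultiplier (m : ℝ → ℝ) (f : E → ℂ) (x : E) : ℂ :=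
  ∫ ξ, (m ‖ξ‖ : ℂ) * 𝓕 f ξ * Complex.exp (2 * π * Complex.I * (⟪x, ξ⟫ : ℝ))

theorem radialMultiplier_eq_fourierInv (m : ℝ → ℝ) (f : E → ℂ) (x : E) :
    radialMultiplier m f x = 𝓕⁻ (fun ξ => (m ‖ξ‖ : ℂ) * 𝓕 f ξ) x := by
  rw [radialMultiplier, Real.fourierInv_eq']
  refine integral_congr_ae (Filter.Eventually.of_forall fun ξ => ?_)
  simp only [smul_eq_mul]
  rw [mul_comm, real_inner_comm]
  congr 2
  push_cast
  ring

theorem measurable_radialMultiplier_symbolDiff (δ : ℝ) (f : SchwartzMap E ℂ) :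
    Measurable fun z : E × ℝ => radialMultiplier (fun a => symbolDiff δ a z.2) (⇑f) z.1 := by
  refine StronglyMeasurable.measurable ?_
  unfold radialMultiplier
  refine StronglyMeasurable.integral_prod_right (f := fun (z : E × ℝ) (ξ : E) =>
    (symbolDiff δ ‖ξ‖ z.2 : ℂ) * 𝓕 (⇑f) ξ *
      Complex.exp (2 * π * Complex.I * (⟪z.1, ξ⟫ : ℝ))) ?_
  refine Measurable.stronglyMeasurable ?_
  have h1 : Measurable fun p : (E × ℝ) × E => symbolDiff δ ‖p.2‖ p.1.2 :=
    Measurable.symbolDiff δ measurable_snd.norm (measurable_snd.comp measurable_fst)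
  have h2 : Measurable (𝓕 (⇑f)) := by
    rw [← SchwartzMap.fourier_coe]
    exact (𝓕 f).continuous.measurable
  have h3 : Measurable fun p : (E × ℝ) × E => ⟪p.1.1, p.2⟫ := by fun_prop
  exact ((Complex.measurable_ofReal.comp h1).mul (h2.comp measurable_snd)).mul
    (Complex.measurable_exp.comp ((Complex.measurable_ofReal.comp h3).const_mul _))

theorem lintegral_symbolDiff_mul_fourier_le {δ : ℝ} {C : ℝ≥0}
    (hC : ∀ a, 0 ≤ a → ∫⁻ t in Set.Ioi 0, ENNReal.ofReal (t⁻¹ * symbolDiff δ a t ^ 2) ≤ C)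
    (f : SchwartzMap E ℂ) :
    ∫⁻ t in Set.Ioi (0 : ℝ), ENNReal.ofReal t⁻¹ *
      ∫⁻ ξ, ‖(symbolDiff δ ‖ξ‖ t : ℂ) * 𝓕 (⇑f) ξ‖ₑ ^ 2 ≤ C * ∫⁻ x, ‖f x‖ₑ ^ 2 := by
  have hF : Measurable (𝓕 (⇑f)) := by
    rw [← SchwartzMap.fourier_coe]
    exact (𝓕 f).continuous.measurable
  have hS : Measurable fun p : ℝ × E => symbolDiff δ ‖p.2‖ p.1 :=
    Measurable.symbolDiff δ measurable_snd.norm measurable_fst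
  have hJ : Measurable fun p : ℝ × E => ENNReal.ofReal (p.1⁻¹ * symbolDiff δ ‖p.2‖ p.1 ^ 2) *
      ‖𝓕 (⇑f) p.2‖ₑ ^ 2 :=
    ((measurable_fst.inv.mul (hS.pow_const 2)).ennreal_ofReal).mul
      ((hF.comp measurable_snd).enorm.pow_const 2)
  calc ∫⁻ t in Set.Ioi (0 : ℝ), ENNReal.ofReal t⁻¹ *
        ∫⁻ ξ, ‖(symbolDiff δ ‖ξ‖ t : ℂ) * 𝓕 (⇑f) ξ‖ₑ ^ 2
      = ∫⁻ t in Set.Ioi (0 : ℝ), ∫⁻ ξ, ENNReal.ofReal (t⁻¹ * symbolDiff δ ‖ξ‖ t ^ 2) *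
          ‖𝓕 (⇑f) ξ‖ₑ ^ 2 := by
        refine setLIntegral_congr_fun measurableSet_Ioi fun t ht => ?_
        have ht0 : (0 : ℝ) < t := ht
        rw [← lintegral_const_mul' _ _ ENNReal.ofReal_ne_top]
        refine lintegral_congr fun ξ => ?_
        rw [ENNReal.ofReal_mul (by positivity), enorm_mul, mul_pow, ← mul_assoc,
          ← sq_abs (symbolDiff δ ‖ξ‖ t), ENNReal.ofReal_pow (abs_nonneg _),
          ← Real.enorm_eq_ofReal_abs]
        congr 3
        rw [← ofReal_norm, ← ofReal_norm, Complex.norm_real]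
    _ = ∫⁻ ξ, ∫⁻ t in Set.Ioi (0 : ℝ), ENNReal.ofReal (t⁻¹ * symbolDiff δ ‖ξ‖ t ^ 2) *
          ‖𝓕 (⇑f) ξ‖ₑ ^ 2 := lintegral_lintegral_swap hJ.aemeasurable
    _ ≤ ∫⁻ ξ, C * ‖𝓕 (⇑f) ξ‖ₑ ^ 2 := by
        refine lintegral_mono fun ξ => ?_
        simp only
        rw [lintegral_mul_const' _ _ (by finiteness)]
        gcongr
        exact hC _ (norm_nonneg _)
    _ = C * ∫⁻ x, ‖f x‖ₑ ^ 2 := by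
        rw [lintegral_const_mul' _ _ ENNReal.coe_ne_top, lintegral_enorm_fourier_schwartz_sq]

theorem memLp_gaussian_mul_fourier (f : SchwartzMap E ℂ) (p : ℝ≥0∞) {s : ℝ} (hs : 0 ≤ s) :
    MemLp (fun ξ : E => (Real.exp (-π * s * ‖ξ‖ ^ 2) : ℂ) * 𝓕 (⇑f) ξ) p := by
  have hc : Continuous fun ξ : E => (Real.exp (-π * s * ‖ξ‖ ^ 2) : ℂ) * 𝓕 f ξ := by fun_prop
  rw [← SchwartzMap.fourier_coe]
  refine ((𝓕 f).memLp p).mono hc.aestronglyMeasurable (Filter.Eventually.of_forall fun ξ => ?_)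
  rw [norm_mul, Complex.norm_real, Real.norm_of_nonneg (Real.exp_pos _).le]
  refine mul_le_of_le_one_left (norm_nonneg _) (Real.exp_le_one_iff.2 ?_)
  have : 0 ≤ π * s * ‖ξ‖ ^ 2 := by positivity
  linarith

theorem pPow_mul_eq (δ a t : ℝ) (z : ℂ) :
    (pPow (1 - a ^ 2 / t ^ 2) δ : ℂ) * z =
      (symbolDiff δ a t : ℂ) * z + (Real.exp (-π * (t ^ 2)⁻¹ * a ^ 2) : ℂ) * z := by
  rw [← add_mul, symbolDiff, Complex.ofReal_sub, sub_add_cancel]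

/-- If the symbol difference produces an `L²` function, then this function is also integrable,
because the Bochner–Riesz symbol has bounded support. -/
theorem integrable_symbolDiff_mul_fourier {δ t : ℝ} (ht : 0 < t) (f : SchwartzMap E ℂ)
    (h : MemLp (fun ξ : E => (symbolDiff δ ‖ξ‖ t : ℂ) * 𝓕 (⇑f) ξ) 2) :
    Integrable fun ξ : E => (symbolDiff δ ‖ξ‖ t : ℂ) * 𝓕 (⇑f) ξ := by
  have hs : 0 ≤ (t ^ 2)⁻¹ := by positivity
  have hP2 : MemLp (fun ξ : E => (pPow (1 - ‖ξ‖ ^ 2 / t ^ 2) δ : ℂ) * 𝓕 (⇑f) ξ) 2 := by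
    simp_rw [pPow_mul_eq]
    exact h.add (memLp_gaussian_mul_fourier f 2 hs)
  have hsupp : Function.support (fun ξ : E => (pPow (1 - ‖ξ‖ ^ 2 / t ^ 2) δ : ℂ) * 𝓕 (⇑f) ξ) ⊆
      Metric.ball 0 t := by
    intro ξ hξ
    rw [Function.mem_support] at hξ
    have hp : 0 < 1 - ‖ξ‖ ^ 2 / t ^ 2 := by
      by_contra hcon
      exact hξ (by simp [pPow, hcon])
    rw [sub_pos, div_lt_one (by positivity)] at hp
    rw [mem_ball_zero_iff]
    exact lt_of_pow_lt_pow_left₀ 2 ht.le hp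
  have hP1 : Integrable fun ξ : E => (pPow (1 - ‖ξ‖ ^ 2 / t ^ 2) δ : ℂ) * 𝓕 (⇑f) ξ := by
    rw [← integrableOn_iff_integrable_of_support_subset hsupp]
    have : IsFiniteMeasure ((volume : Measure E).restrict (Metric.ball 0 t)) :=
      ⟨by simpa using measure_ball_lt_top⟩
    exact (hP2.restrict _).integrable (by norm_num)
  refine (hP1.sub (memLp_one_iff_integrable.1 (memLp_gaussian_mul_fourier f 1 hs))).congr
    (Filter.Eventually.of_forall fun ξ => ?_)
  simp only [Pi.sub_apply, pPow_mul_eq, add_sub_cancel_right]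

theorem MeasureTheory.Integrable.mul_cexp_inner {g : E → ℂ} (hg : Integrable g) (x : E) :
    Integrable fun ξ => g ξ * Complex.exp (2 * π * Complex.I * (⟪x, ξ⟫ : ℝ)) := by
  have hc : Continuous fun ξ : E => Complex.exp (2 * π * Complex.I * (⟪x, ξ⟫ : ℝ)) := by fun_prop
  refine hg.mono (hg.aestronglyMeasurable.mul hc.aestronglyMeasurable)
    (Filter.Eventually.of_forall fun ξ => ?_)
  rw [norm_mul, Complex.norm_exp]
  simp

theorem ENNReal.add_sq_le (a b : ℝ≥0∞) : (a + b) ^ 2 ≤ 2 * a ^ 2 + 2 * b ^ 2 := by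
  have := ENNReal.rpow_add_le_mul_rpow_add_rpow a b (p := 2) (by norm_num)
  norm_num at this
  rwa [mul_add] at this

/-- A Bochner–Riesz mean is controlled by the corresponding symbol difference operator and the
Gaussian maximal function. -/
theorem enorm_bochnerRiesz_sq_le {δ t : ℝ} (ht : 0 < t) (f : SchwartzMap E ℂ)
    (h : MemLp (fun ξ : E => (symbolDiff δ ‖ξ‖ t : ℂ) * 𝓕 (⇑f) ξ) 2) (x : E) :
    ‖∫ ξ, (pPow (1 - ‖ξ‖ ^ 2 / t ^ 2) δ : ℂ) * 𝓕 (⇑f) ξ *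
        Complex.exp (2 * π * Complex.I * (⟪x, ξ⟫ : ℝ))‖ₑ ^ 2 ≤
      2 * ‖radialMultiplier (fun a => symbolDiff δ a t) (⇑f) x‖ₑ ^ 2 +
      2 * (((2 ^ (Module.finrank ℝ E / 2 : ℝ) : ℝ≥0) : ℝ≥0∞) *
        heatMaximal (fun y => ‖f y‖ₑ) x) ^ 2 := by
  have hs : 0 < (t ^ 2)⁻¹ := by positivity
  simp_rw [pPow_mul_eq, add_mul]
  rw [integral_add ((integrable_symbolDiff_mul_fourier ht f h).mul_cexp_inner x)
    ((memLp_one_iff_integrable.1 (memLp_gaussian_mul_fourier f 1 hs.le)).mul_cexp_inner x)]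
  calc _ ≤ (‖radialMultiplier (fun a => symbolDiff δ a t) (⇑f) x‖ₑ +
        ((2 ^ (Module.finrank ℝ E / 2 : ℝ) : ℝ≥0) : ℝ≥0∞) *
          heatMaximal (fun y => ‖f y‖ₑ) x) ^ 2 := by
        gcongr
        refine (enorm_add_le _ _).trans (add_le_add le_rfl ?_)
        exact (enorm_integral_gaussian_mul_fourier_le f.integrable hs x).trans
          (heatAverage_le_heatMaximal hs _ x)
    _ ≤ _ := ENNReal.add_sq_le _ _

theorem ofReal_average_norm_sq_le {b : ℝ → ℂ} {D : ℝ → ℝ≥0∞} {M : ℝ≥0∞}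
    (h : ∀ᵐ t ∂volume.restrict (Set.Ioi (0 : ℝ)), ‖b t‖ₑ ^ 2 ≤ D t + M) {R : ℝ} (hR : 0 < R) :
    ENNReal.ofReal (R⁻¹ * ∫ t in (0 : ℝ)..R, ‖b t‖ ^ 2) ≤
      (∫⁻ t in Set.Ioi (0 : ℝ), ENNReal.ofReal t⁻¹ * D t) + M := by
  rw [intervalIntegral.integral_of_le hR.le, ENNReal.ofReal_mul (by positivity)]
  calc ENNReal.ofReal R⁻¹ * ENNReal.ofReal (∫ t in Set.Ioc 0 R, ‖b t‖ ^ 2)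
      ≤ ENNReal.ofReal R⁻¹ * ∫⁻ t in Set.Ioc 0 R, ‖b t‖ₑ ^ 2 := by
        gcongr
        refine (Real.ofReal_le_enorm _).trans ((enorm_integral_le_lintegral_enorm _).trans_eq ?_)
        simp
    _ = ∫⁻ t in Set.Ioc 0 R, ENNReal.ofReal R⁻¹ * ‖b t‖ₑ ^ 2 :=
        (lintegral_const_mul' _ _ ENNReal.ofReal_ne_top).symm
    _ ≤ ∫⁻ t in Set.Ioc 0 R, (ENNReal.ofReal t⁻¹ * D t + ENNReal.ofReal R⁻¹ * M) := by
        refine lintegral_mono_ae ?_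
        filter_upwards [ae_mono (Measure.restrict_mono_set _ Set.Ioc_subset_Ioi_self) h,
          ae_restrict_mem measurableSet_Ioc] with t hb ht
        have ht0 : 0 < t := ht.1
        calc ENNReal.ofReal R⁻¹ * ‖b t‖ₑ ^ 2 ≤ ENNReal.ofReal R⁻¹ * (D t + M) := by gcongr
          _ ≤ _ := by
            rw [mul_add]
            gcongr
            exact ht.2
    _ = (∫⁻ t in Set.Ioc 0 R, ENNReal.ofReal t⁻¹ * D t) + M := by
        rw [lintegral_add_right _ measurable_const, lintegral_const, Measure.restrict_apply_univ,
          Real.volume_Ioc, sub_zero, mul_right_comm, ← ENNReal.ofReal_mul (by positivity),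
          inv_mul_cancel₀ hR.ne', ENNReal.ofReal_one, one_mul]
    _ ≤ _ := by
        gcongr
        exact Set.Ioc_subset_Ioi_self

/-- The square function of the symbol differences is bounded on `L²`. -/
theorem lintegral_lintegral_radialMultiplier_symbolDiff_le {δ : ℝ} {C : ℝ≥0}
    (hC : ∀ a, 0 ≤ a → ∫⁻ t in Set.Ioi 0, ENNReal.ofReal (t⁻¹ * symbolDiff δ a t ^ 2) ≤ C)
    (f : SchwartzMap E ℂ) :
    (∀ᵐ t ∂volume.restrict (Set.Ioi (0 : ℝ)),
      MemLp (fun ξ : E => (symbolDiff δ ‖ξ‖ t : ℂ) * 𝓕 (⇑f) ξ) 2) ∧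
    ∫⁻ x, ∫⁻ t in Set.Ioi (0 : ℝ), ENNReal.ofReal t⁻¹ *
      ‖radialMultiplier (fun a => symbolDiff δ a t) (⇑f) x‖ₑ ^ 2 ≤ C * ∫⁻ x, ‖f x‖ₑ ^ 2 := by
  have hF : Measurable (𝓕 (⇑f)) := by
    rw [← SchwartzMap.fourier_coe]
    exact (𝓕 f).continuous.measurable
  have hS : Measurable fun p : ℝ × E => (symbolDiff δ ‖p.2‖ p.1 : ℂ) * 𝓕 (⇑f) p.2 :=
    (Complex.measurable_ofReal.comp (Measurable.symbolDiff δ measurable_snd.norm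
      measurable_fst)).mul (hF.comp measurable_snd)
  have hsq : ∀ u : E → ℂ, eLpNorm u 2 volume ^ 2 = ∫⁻ x, ‖u x‖ₑ ^ 2 := by
    intro u
    simpa using eLpNorm_nnreal_pow_eq_lintegral (f := u) (μ := volume) (p := 2) (by norm_num)
  have hle := lintegral_symbolDiff_mul_fourier_le hC f
  have hfin : ∫⁻ x, ‖f x‖ₑ ^ 2 ≠ ∞ := by
    have hf : MemLp (⇑f) 2 volume := f.memLp 2
    rw [← hsq]
    exact ENNReal.pow_ne_top hf.eLpNorm_ne_top
  have hmem : ∀ᵐ t ∂volume.restrict (Set.Ioi (0 : ℝ)),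
      MemLp (fun ξ : E => (symbolDiff δ ‖ξ‖ t : ℂ) * 𝓕 (⇑f) ξ) 2 := by
    have hmeas : Measurable fun t : ℝ => ENNReal.ofReal t⁻¹ *
        ∫⁻ ξ, ‖(symbolDiff δ ‖ξ‖ t : ℂ) * 𝓕 (⇑f) ξ‖ₑ ^ 2 :=
      (ENNReal.measurable_ofReal.comp measurable_inv).mul
        (Measurable.lintegral_prod_right' (f := fun p : ℝ × E =>
          ‖(symbolDiff δ ‖p.2‖ p.1 : ℂ) * 𝓕 (⇑f) p.2‖ₑ ^ 2) (hS.enorm.pow_const 2))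
    filter_upwards [ae_lt_top hmeas (hle.trans_lt (by finiteness)).ne,
      ae_restrict_mem measurableSet_Ioi] with t hlt ht
    have ht0 : (0 : ℝ) < t := ht
    refine ⟨(hS.comp measurable_prodMk_left).aestronglyMeasurable, ?_⟩
    refine (ENNReal.pow_lt_top_iff (n := 2)).1 ?_ |>.resolve_right two_ne_zero
    rw [hsq]
    exact ENNReal.lt_top_of_mul_ne_top_right hlt.ne (by simpa using ht0)
  refine ⟨hmem, le_trans (le_of_eq ?_) hle⟩
  have hJ : Measurable fun p : E × ℝ => ENNReal.ofReal p.2⁻¹ *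
      ‖radialMultiplier (fun a => symbolDiff δ a p.2) (⇑f) p.1‖ₑ ^ 2 :=
    measurable_snd.inv.ennreal_ofReal.mul
      ((measurable_radialMultiplier_symbolDiff δ f).enorm.pow_const 2)
  rw [lintegral_lintegral_swap hJ.aemeasurable]
  refine lintegral_congr_ae ?_
  filter_upwards [hmem, ae_restrict_mem measurableSet_Ioi] with t hm ht
  rw [lintegral_const_mul' _ _ ENNReal.ofReal_ne_top]
  simp_rw [radialMultiplier_eq_fourierInv]
  rw [lintegral_enorm_fourierInv_sq (integrable_symbolDiff_mul_fourier ht f hm) hm]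

/-- The maximal quadratic mean of the Bochner–Riesz means is bounded on `L²`. -/
theorem lintegral_iSup_bochnerRiesz_le {δ : ℝ} {C : ℝ≥0}
    (hC : ∀ a, 0 ≤ a → ∫⁻ t in Set.Ioi 0, ENNReal.ofReal (t⁻¹ * symbolDiff δ a t ^ 2) ≤ C)
    (f : SchwartzMap E ℂ) :
    ∫⁻ x : E, ⨆ (R : ℝ) (_ : 0 < R), ENNReal.ofReal
        (R⁻¹ * ∫ t in (0 : ℝ)..R, ‖∫ ξ, (pPow (1 - ‖ξ‖ ^ 2 / t ^ 2) δ : ℂ) * 𝓕 (⇑f) ξ *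
          Complex.exp (2 * π * Complex.I * (⟪x, ξ⟫ : ℝ))‖ ^ 2) ≤
      ((2 * C + 2 * (2 ^ (Module.finrank ℝ E / 2 : ℝ)) ^ 2 *
        (12 * (2 ^ (Module.finrank ℝ E / 2 : ℝ)) ^ 2 + 2) : ℝ≥0) : ℝ≥0∞) *
        ∫⁻ x, ‖f x‖ₑ ^ 2 := by
  obtain ⟨hmem, hle⟩ := lintegral_lintegral_radialMultiplier_symbolDiff_le hC f
  have hM := lintegral_heatMaximal_sq_le f.continuous.measurable.enorm
  set K : ℝ≥0 := 2 ^ (Module.finrank ℝ E / 2 : ℝ) with hK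
  set N := ∫⁻ x, ‖f x‖ₑ ^ 2 with hN
  have hmeas : Measurable (heatMaximal fun y => ‖f y‖ₑ) :=
    measurable_heatMaximal f.continuous.measurable.enorm
  calc _ ≤ ∫⁻ x, ((∫⁻ t in Set.Ioi (0 : ℝ), ENNReal.ofReal t⁻¹ *
          (2 * ‖radialMultiplier (fun a => symbolDiff δ a t) (⇑f) x‖ₑ ^ 2)) +
          2 * (K * heatMaximal (fun y => ‖f y‖ₑ) x) ^ 2) := by
        refine lintegral_mono fun x => iSup₂_le fun R hR => ofReal_average_norm_sq_le ?_ hR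
        filter_upwards [hmem, ae_restrict_mem measurableSet_Ioi] with t hm ht
        exact enorm_bochnerRiesz_sq_le ht f hm x
    _ = 2 * (∫⁻ x, ∫⁻ t in Set.Ioi (0 : ℝ), ENNReal.ofReal t⁻¹ *
          ‖radialMultiplier (fun a => symbolDiff δ a t) (⇑f) x‖ₑ ^ 2) +
          2 * K ^ 2 * ∫⁻ x, heatMaximal (fun y => ‖f y‖ₑ) x ^ 2 := by
        rw [lintegral_add_right _ (((hmeas.const_mul _).pow_const 2).const_mul _)]
        congr 1
        · simp_rw [mul_left_comm _ (2 : ℝ≥0∞), lintegral_const_mul' _ _ ENNReal.ofNat_ne_top]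
        · simp_rw [mul_pow, ← mul_assoc]
          rw [lintegral_const_mul' _ _ (by finiteness)]
    _ ≤ 2 * (C * N) + 2 * K ^ 2 * ((12 * K ^ 2 + 2) * N) := by gcongr
    _ = _ := by
        push_cast
        ring

end BochnerRiesz

theorem stmt9 (n : ℕ) (hn : 1 ≤ n) (δ : ℝ) (hδ : -(1/2) < δ) :
    ∃ C > (0:ℝ), ∀ f : SchwartzMap (EuclideanSpace ℝ (Fin n)) ℂ,
      (∫⁻ x : EuclideanSpace ℝ (Fin n),
          ⨆ (R : ℝ) (_ : 0 < R), ENNReal.ofReal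
            (R⁻¹ * ∫ t in (0:ℝ)..R,
              ‖∫ ξ, (pPow (1 - ‖ξ‖^2 / t^2) δ : ℂ) * 𝓕 (⇑f) ξ *
                Complex.exp (2 * Real.pi * Complex.I * (⟪x, ξ⟫ : ℝ))‖^2)) ^ (1/2 : ℝ)
        ≤ ENNReal.ofReal C * eLpNorm (⇑f) 2 volume := by
  obtain ⟨C, hC⟩ := exists_lintegral_symbolDiff_le hδ
  set d := Module.finrank ℝ (EuclideanSpace ℝ (Fin n))
  set A : ℝ≥0 := 2 * C + 2 * (2 ^ (d / 2 : ℝ)) ^ 2 * (12 * (2 ^ (d / 2 : ℝ)) ^ 2 + 2)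
  have hA0 : 0 < A := by positivity
  refine ⟨(A ^ (1 / 2 : ℝ) : ℝ≥0), NNReal.coe_pos.2 (NNReal.rpow_pos hA0), fun f => ?_⟩
  have hsq : eLpNorm f 2 volume ^ 2 = ∫⁻ x, ‖f x‖ₑ ^ 2 := by
    simpa using eLpNorm_nnreal_pow_eq_lintegral (f := f) (μ := volume) (p := 2) (by norm_num)
  have hroot : eLpNorm f 2 volume = (eLpNorm f 2 volume ^ 2) ^ (1 / 2 : ℝ) := by
    rw [← ENNReal.rpow_natCast, ← ENNReal.rpow_mul]
    norm_num
  rw [ENNReal.ofReal_coe_nnreal, ENNReal.coe_rpow_of_nonneg _ (by norm_num), hroot, hsq,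
    ← ENNReal.mul_rpow_of_nonneg _ _ (by norm_num)]
  exact ENNReal.rpow_le_rpow (lintegral_iSup_bochnerRiesz_le hC f) (by norm_num)
end

section
/- Let n ≥ 1 and let F : (0,∞) × ℝⁿ → ℂ be measurable with ∫₀^∞ ‖F(t, ·)‖²_{L^p} t^{-1} dt < ∞ for some 1 < p < ∞. Then ‖ (∫₀^∞ |M(F(t,·))(x)|² t^{-1} dt)^{1/2} ‖_{L^p(ℝⁿ)} ≤ C(n,p) ‖ (∫₀^∞ |F(t,·)(x)|² t^{-1} dt)^{1/2} ‖_{L^p(ℝⁿ)}, where M denotes the Hardy–Littlewood maximal operator acting in the x-variable for each fixed t. -/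
open MeasureTheory Real
open scoped ENNReal NNReal

/-- The Hardy–Littlewood maximal function (with values in `ℝ≥0∞`). -/
noncomputable def hlMaximal {n : ℕ} (f : EuclideanSpace ℝ (Fin n) → ℂ)
    (x : EuclideanSpace ℝ (Fin n)) : ℝ≥0∞ :=
  ⨆ (r : ℝ) (_ : 0 < r),
    (volume (Metric.ball x r))⁻¹ * ∫⁻ y in Metric.ball x r, ‖f y‖₊

open Metric

/-- The centered maximal function of a measure, over closed balls of dyadic radii. -/
noncomputable def dyadicMaximal {E : Type*} [PseudoMetricSpace E] [MeasurableSpace E]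
    (μ : Measure E) (g : E → ℝ≥0∞) (x : E) : ℝ≥0∞ :=
  ⨆ k : ℤ, (μ (closedBall x ((2 : ℝ) ^ k)))⁻¹ * ∫⁻ y in closedBall x ((2 : ℝ) ^ k), g y ∂μ

/-- The centered maximal function of an arbitrary measure is of weak type `(1, 1)`. -/
theorem exists_weakType_dyadicMaximal (E : Type*) [MetricSpace E] [SecondCountableTopology E]
    [MeasurableSpace E] [OpensMeasurableSpace E] [HasBesicovitchCovering E] :
    ∃ N : ℕ, ∀ (μ : Measure E) (g : E → ℝ≥0∞) (c : ℝ≥0∞),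
      c * μ {x | c < dyadicMaximal μ g x} ≤ N * ∫⁻ y, g y ∂μ := by
  obtain ⟨N, τ, hτ, hN⟩ := HasBesicovitchCovering.no_satelliteConfig (α := E)
  refine ⟨N, fun μ g c => ?_⟩
  let A : ℤ → Set E := fun K => {x | ∃ k ≤ K, c * μ (closedBall x ((2 : ℝ) ^ k)) ≤
    ∫⁻ y in closedBall x ((2 : ℝ) ^ k), g y ∂μ}
  have hsub : {x | c < dyadicMaximal μ g x} ⊆ ⋃ K, A K := by
    intro x hx
    obtain ⟨k, hk⟩ := lt_iSup_iff.1 (show c < ⨆ k : ℤ, _ from hx)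
    refine Set.mem_iUnion.2 ⟨k, k, le_rfl, ?_⟩
    rw [mul_comm, ← div_eq_mul_inv] at hk
    exact ENNReal.mul_le_of_le_div hk.le
  have hmono : Monotone A := fun K L hKL x ⟨k, hk, h⟩ => ⟨k, hk.trans hKL, h⟩
  have hA : ∀ K, c * μ (A K) ≤ N * ∫⁻ y, g y ∂μ := by
    intro K
    choose k hkK hk using fun x : A K => x.2
    let q : Besicovitch.BallPackage (A K) E :=
      { c := fun x => x
        r := fun x => (2 : ℝ) ^ k x
        rpos := fun x => by positivity
        r_bound := (2 : ℝ) ^ K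
        r_le := fun x => zpow_le_zpow_right₀ (by norm_num) (hkK x) }
    obtain ⟨s, hs, hcov⟩ := Besicovitch.exist_disjoint_covering_families hτ hN q
    have hcount : ∀ i, (s i).Countable := fun i =>
      (hs i).countable_of_nonempty_interior fun x _ =>
        ⟨q.c x, ball_subset_interior_closedBall (mem_ball_self (q.rpos x))⟩
    have hAs : A K ⊆ ⋃ i, ⋃ j ∈ s i, closedBall (q.c j) (q.r j) := by
      intro x hx
      have := hcov ⟨⟨x, hx⟩, rfl⟩
      simp only [Set.mem_iUnion] at this ⊢
      obtain ⟨i, j, hj, h⟩ := this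
      exact ⟨i, j, hj, ball_subset_closedBall h⟩
    have hfam : ∀ i, c * μ (⋃ j ∈ s i, closedBall (q.c j) (q.r j)) ≤ ∫⁻ y, g y ∂μ := by
      intro i
      rw [measure_biUnion (hcount i) (hs i) fun j _ => measurableSet_closedBall,
        ← ENNReal.tsum_mul_left]
      calc ∑' j : s i, c * μ (closedBall (q.c j) (q.r j))
          ≤ ∑' j : s i, ∫⁻ y in closedBall (q.c j) (q.r j), g y ∂μ :=
            ENNReal.tsum_le_tsum fun j => hk j
        _ = ∫⁻ y in ⋃ j ∈ s i, closedBall (q.c j) (q.r j), g y ∂μ :=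
            (lintegral_biUnion (hcount i) (fun j _ => measurableSet_closedBall) (hs i) _).symm
        _ ≤ ∫⁻ y, g y ∂μ := setLIntegral_le_lintegral _ _
    calc c * μ (A K) ≤ c * ∑ i, μ (⋃ j ∈ s i, closedBall (q.c j) (q.r j)) := by
          gcongr
          exact (measure_mono hAs).trans (measure_iUnion_fintype_le _ _)
      _ = ∑ i, c * μ (⋃ j ∈ s i, closedBall (q.c j) (q.r j)) := Finset.mul_sum _ _ _
      _ ≤ ∑ _i : Fin N, ∫⁻ y, g y ∂μ := Finset.sum_le_sum fun i _ => hfam i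
      _ = N * ∫⁻ y, g y ∂μ := by simp
  calc c * μ {x | c < dyadicMaximal μ g x} ≤ c * μ (⋃ K, A K) := by gcongr
    _ = ⨆ K, c * μ (A K) := by rw [hmono.measure_iUnion, ENNReal.mul_iSup]
    _ ≤ N * ∫⁻ y, g y ∂μ := iSup_le hA

theorem measurable_dyadicMaximal_uncurry {T E : Type*} [MeasurableSpace T] [PseudoMetricSpace E]
    [SecondCountableTopology E] [MeasurableSpace E] [OpensMeasurableSpace E]
    (μ : Measure E) [SFinite μ] {f : T → E → ℝ≥0∞} (hf : Measurable (Function.uncurry f)) :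
    Measurable fun z : T × E => dyadicMaximal μ (f z.1) z.2 := by
  have key : ∀ (r : ℝ) (g : T → E → ℝ≥0∞), Measurable (Function.uncurry g) →
      Measurable fun z : T × E => ∫⁻ y in closedBall z.2 r, g z.1 y ∂μ := by
    intro r g hg
    have hset : MeasurableSet {w : (T × E) × E | dist w.2 w.1.2 ≤ r} :=
      measurableSet_le (measurable_snd.dist (measurable_snd.comp measurable_fst))
        measurable_const
    have hm : Measurable ({w : (T × E) × E | dist w.2 w.1.2 ≤ r}.indicator
        fun w => g w.1.1 w.2) :=
      (hg.comp ((measurable_fst.comp measurable_fst).prodMk measurable_snd)).indicator hset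
    convert hm.lintegral_prod_right' (ν := μ) using 2 with z
    rw [← lintegral_indicator measurableSet_closedBall]
    rfl
  have hvol : ∀ r : ℝ, Measurable fun z : T × E => μ (closedBall z.2 r) := fun r => by
    simpa using key r (fun _ _ => 1) measurable_const
  exact Measurable.iSup fun k => (hvol _).inv.mul (key _ f hf)

theorem measurable_dyadicMaximal {E : Type*} [PseudoMetricSpace E]
    [SecondCountableTopology E] [MeasurableSpace E] [OpensMeasurableSpace E]
    (μ : Measure E) [SFinite μ] {g : E → ℝ≥0∞} (hg : Measurable g) :
    Measurable (dyadicMaximal μ g) := by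
  have hu : Measurable (Function.uncurry fun _ : E => g) := hg.comp measurable_snd
  have h := measurable_dyadicMaximal_uncurry μ hu
  simpa only [Function.comp_def, id] using h.comp (measurable_id.prodMk measurable_id)

theorem average_le_dyadicMaximal {E : Type*} [PseudoMetricSpace E] [MeasurableSpace E]
    (μ : Measure E) (g : E → ℝ≥0∞) (x : E) (k : ℤ) :
    (μ (closedBall x ((2 : ℝ) ^ k)))⁻¹ * ∫⁻ y in closedBall x ((2 : ℝ) ^ k), g y ∂μ ≤
      dyadicMaximal μ g x :=
  le_iSup (fun k : ℤ =>
    (μ (closedBall x ((2 : ℝ) ^ k)))⁻¹ * ∫⁻ y in closedBall x ((2 : ℝ) ^ k), g y ∂μ) k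

theorem dyadicMaximal_const_mul {E : Type*} [PseudoMetricSpace E] [MeasurableSpace E]
    (μ : Measure E) (c : ℝ≥0∞) {g : E → ℝ≥0∞} (hg : Measurable g) (x : E) :
    dyadicMaximal μ (fun y => c * g y) x = c * dyadicMaximal μ g x := by
  simp only [dyadicMaximal, ENNReal.mul_iSup]
  congr! 2 with k
  rw [lintegral_const_mul c hg]
  ring

theorem dyadicMaximal_tsum_le {E : Type*} [PseudoMetricSpace E] [MeasurableSpace E]
    (μ : Measure E) {g : ℕ → E → ℝ≥0∞} (hg : ∀ i, Measurable (g i)) (x : E) :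
    dyadicMaximal μ (fun y => ∑' i, g i y) x ≤ ∑' i, dyadicMaximal μ (g i) x := by
  refine iSup_le fun k => ?_
  rw [lintegral_tsum fun i => (hg i).aemeasurable, ← ENNReal.tsum_mul_left]
  exact ENNReal.tsum_le_tsum fun i => average_le_dyadicMaximal μ (g i) x k

/-- Removing the part of `g` below the level `c` lowers the maximal function by at most `c`. -/
theorem dyadicMaximal_le_indicator_add {E : Type*} [PseudoMetricSpace E] [MeasurableSpace E]
    (μ : Measure E) {g : E → ℝ≥0∞} (c : ℝ≥0∞) (x : E) :
    dyadicMaximal μ g x ≤ dyadicMaximal μ ({y | c < g y}.indicator g) x + c := by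
  refine iSup_le fun k => ?_
  set B := closedBall x ((2 : ℝ) ^ k)
  calc (μ B)⁻¹ * ∫⁻ y in B, g y ∂μ
      ≤ (μ B)⁻¹ * ∫⁻ y in B, ({y | c < g y}.indicator g y + c) ∂μ := by
        gcongr with y
        by_cases h : c < g y
        · simp [Set.indicator, h]
        · simpa [Set.indicator, h] using not_lt.1 h
    _ = (μ B)⁻¹ * (∫⁻ y in B, {y | c < g y}.indicator g y ∂μ) + (μ B)⁻¹ * μ B * c := by
        rw [lintegral_add_right _ measurable_const, setLIntegral_const]
        ring
    _ ≤ _ := add_le_add (average_le_dyadicMaximal μ _ x k)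
        (mul_le_of_le_one_left' (ENNReal.inv_mul_le_one _))

theorem lintegral_rpow_sub_one_indicator_lt {q : ℝ} (hq : 0 < q) (a : ℝ≥0∞) :
    ∫⁻ l in Set.Ioi (0 : ℝ), {l : ℝ | ENNReal.ofReal l < a}.indicator
      (fun l => ENNReal.ofReal (q * l ^ (q - 1))) l = a ^ q := by
  have hfin : ∀ b : ℝ, 0 ≤ b →
      ∫⁻ l in Set.Ioo 0 b, ENNReal.ofReal (q * l ^ (q - 1)) = ENNReal.ofReal (b ^ q) := by
    intro b hb
    rw [← ofReal_integral_eq_lintegral_ofReal]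
    · rw [← integral_Ioc_eq_integral_Ioo, ← intervalIntegral.integral_of_le hb,
        intervalIntegral.integral_const_mul, integral_rpow (Or.inl (by linarith))]
      congr 1
      simp only [sub_add_cancel]
      rw [Real.zero_rpow hq.ne']
      field_simp
      simp
    · have := (intervalIntegral.intervalIntegrable_rpow' (a := 0) (b := b) (r := q - 1)
        (by linarith)).const_mul q
      rw [intervalIntegrable_iff_integrableOn_Ioo_of_le hb] at this
      exact this
    · filter_upwards [ae_restrict_mem measurableSet_Ioo] with l hl
      have := Real.rpow_nonneg hl.1.le (q - 1)
      positivity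
  have hset : MeasurableSet {l : ℝ | ENNReal.ofReal l < a} :=
    measurableSet_lt ENNReal.measurable_ofReal measurable_const
  rw [lintegral_indicator hset, Measure.restrict_restrict hset]
  induction a with
  | top =>
    rw [ENNReal.top_rpow_of_pos hq, eq_top_iff]
    refine ENNReal.le_of_forall_nnreal_lt fun r _ => ?_
    have h := hfin ((r : ℝ) ^ q⁻¹) (by positivity)
    rw [← Real.rpow_mul r.coe_nonneg, inv_mul_cancel₀ hq.ne', Real.rpow_one, ENNReal.ofReal_coe_nnreal] at h
    rw [← h]
    refine lintegral_mono_set fun l hl => ⟨ENNReal.ofReal_lt_top, hl.1⟩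
  | coe b =>
    have : {l : ℝ | ENNReal.ofReal l < b} ∩ Set.Ioi 0 = Set.Ioo 0 (b : ℝ) := by
      ext l
      simp only [Set.mem_inter_iff, Set.mem_ofPred_eq, Set.mem_Ioi, Set.mem_Ioo]
      rw [and_comm]
      refine and_congr_right fun hl => ?_
      rw [← ENNReal.ofReal_coe_nnreal, ENNReal.ofReal_lt_ofReal_iff_of_nonneg hl.le]
    rw [this, hfin b b.coe_nonneg, ← ENNReal.ofReal_rpow_of_nonneg b.coe_nonneg hq.le, ENNReal.ofReal_coe_nnreal]

theorem lintegral_rpow_eq_lintegral_mul_indicator {α : Type*} [MeasurableSpace α]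
    (μ : Measure α) [SFinite μ] {q : ℝ} (hq : 0 < q) {a w : α → ℝ≥0∞} (ha : Measurable a)
    (hw : Measurable w) :
    ∫⁻ x, w x * a x ^ q ∂μ = ∫⁻ l in Set.Ioi (0 : ℝ), ENNReal.ofReal (q * l ^ (q - 1)) *
      ∫⁻ x, {x | ENNReal.ofReal l < a x}.indicator w x ∂μ := by
  have hD : Measurable fun l : ℝ => ENNReal.ofReal (q * l ^ (q - 1)) := by fun_prop
  have hs : MeasurableSet {z : α × ℝ | ENNReal.ofReal z.2 < a z.1} :=
    measurableSet_lt (by fun_prop) (by fun_prop)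
  have hm : Measurable (Function.uncurry fun (x : α) (l : ℝ) =>
      w x * {l : ℝ | ENNReal.ofReal l < a x}.indicator
        (fun l => ENNReal.ofReal (q * l ^ (q - 1))) l) :=
    (hw.comp measurable_fst).mul ((hD.comp measurable_snd).indicator hs)
  calc ∫⁻ x, w x * a x ^ q ∂μ
      = ∫⁻ x, (∫⁻ l in Set.Ioi (0 : ℝ), w x * {l : ℝ | ENNReal.ofReal l < a x}.indicator
          (fun l => ENNReal.ofReal (q * l ^ (q - 1))) l) ∂μ := by
        refine lintegral_congr fun x => ?_
        rw [lintegral_const_mul _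
          (hD.indicator (measurableSet_lt (by fun_prop) measurable_const)),
          lintegral_rpow_sub_one_indicator_lt hq]
    _ = ∫⁻ l in Set.Ioi (0 : ℝ), ∫⁻ x, w x * {l : ℝ | ENNReal.ofReal l < a x}.indicator
          (fun l => ENNReal.ofReal (q * l ^ (q - 1))) l ∂μ :=
        lintegral_lintegral_swap hm.aemeasurable
    _ = _ := by
        refine lintegral_congr fun l => ?_
        rw [← lintegral_const_mul _ (hw.indicator (measurableSet_lt measurable_const ha))]
        refine lintegral_congr fun x => ?_
        by_cases h : ENNReal.ofReal l < a x <;> simp [Set.indicator, h, mul_comm]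

/-- The centered maximal function of an arbitrary measure is bounded on `L^q`, `1 < q`. -/
theorem exists_lintegral_dyadicMaximal_rpow_le (E : Type*) [MetricSpace E]
    [SecondCountableTopology E] [MeasurableSpace E] [OpensMeasurableSpace E]
    [HasBesicovitchCovering E] {q : ℝ} (hq : 1 < q) :
    ∃ C : ℝ≥0, ∀ (μ : Measure E) [SFinite μ] (g : E → ℝ≥0∞), Measurable g →
      ∫⁻ x, dyadicMaximal μ g x ^ q ∂μ ≤ C * ∫⁻ x, g x ^ q ∂μ := by
  obtain ⟨N, hN⟩ := exists_weakType_dyadicMaximal E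
  have hq' : 0 < q - 1 := sub_pos.2 hq
  refine ⟨N * (2 * q / (q - 1)).toNNReal * 2 ^ (q - 1), fun μ _ g hg => ?_⟩
  have hlevel : ∀ l : ℝ, 0 < l →
      ENNReal.ofReal (q * l ^ (q - 1)) * μ {x | ENNReal.ofReal l < dyadicMaximal μ g x} ≤
        N * ENNReal.ofReal (2 * q / (q - 1)) * (ENNReal.ofReal ((q - 1) * l ^ (q - 1 - 1)) *
          ∫⁻ x, {x | ENNReal.ofReal l < 2 * g x}.indicator g x ∂μ) := by
    intro l hl
    have hhalf : ENNReal.ofReal l = 2 * ENNReal.ofReal (l / 2) := by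
      rw [← ENNReal.ofReal_ofNat 2, ← ENNReal.ofReal_mul (by norm_num)]
      congr 1
      ring
    have hset : {x | ENNReal.ofReal l < 2 * g x} = {x | ENNReal.ofReal (l / 2) < g x} := by
      ext x
      simp only [Set.mem_ofPred_eq, hhalf]
      exact ENNReal.mul_lt_mul_iff_right (by norm_num) (by norm_num)
    have hsub : {x | ENNReal.ofReal l < dyadicMaximal μ g x} ⊆ {x | ENNReal.ofReal (l / 2) <
        dyadicMaximal μ ({x | ENNReal.ofReal (l / 2) < g x}.indicator g) x} := by
      intro x hx
      by_contra h
      refine absurd (Set.mem_ofPred_eq ▸ hx) (not_lt.2 ?_)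
      rw [hhalf, two_mul]
      exact (dyadicMaximal_le_indicator_add μ _ x).trans (add_le_add_left (not_lt.1 h) _)
    have hcoef : ENNReal.ofReal (q * l ^ (q - 1)) = ENNReal.ofReal (2 * q / (q - 1)) *
        ENNReal.ofReal ((q - 1) * l ^ (q - 1 - 1)) * ENNReal.ofReal (l / 2) := by
      rw [← ENNReal.ofReal_mul (by positivity), ← ENNReal.ofReal_mul (by positivity)]
      congr 1
      rw [Real.rpow_sub_one hl.ne' (q - 1)]
      field_simp
    rw [hset, hcoef]
    calc _ ≤ ENNReal.ofReal (2 * q / (q - 1)) * ENNReal.ofReal ((q - 1) * l ^ (q - 1 - 1)) *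
          (ENNReal.ofReal (l / 2) * μ {x | ENNReal.ofReal (l / 2) <
            dyadicMaximal μ ({x | ENNReal.ofReal (l / 2) < g x}.indicator g) x}) := by
          rw [mul_assoc]
          gcongr
      _ ≤ ENNReal.ofReal (2 * q / (q - 1)) * ENNReal.ofReal ((q - 1) * l ^ (q - 1 - 1)) *
          (N * ∫⁻ x, {x | ENNReal.ofReal (l / 2) < g x}.indicator g x ∂μ) := by
          exact mul_le_mul_right (hN μ _ _) _
      _ = _ := by ring
  have hM := measurable_dyadicMaximal μ hg
  calc ∫⁻ x, dyadicMaximal μ g x ^ q ∂μ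
      = ∫⁻ l in Set.Ioi (0 : ℝ), ENNReal.ofReal (q * l ^ (q - 1)) *
          μ {x | ENNReal.ofReal l < dyadicMaximal μ g x} := by
        have h := lintegral_rpow_eq_lintegral_mul_indicator μ (zero_lt_one.trans hq) hM
          (measurable_const (a := (1 : ℝ≥0∞)))
        simp only [one_mul] at h
        rw [h]
        refine lintegral_congr fun l => ?_
        rw [lintegral_indicator_const (measurableSet_lt measurable_const hM), one_mul]
    _ ≤ ∫⁻ l in Set.Ioi (0 : ℝ), N * ENNReal.ofReal (2 * q / (q - 1)) *
          (ENNReal.ofReal ((q - 1) * l ^ (q - 1 - 1)) *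
            ∫⁻ x, {x | ENNReal.ofReal l < 2 * g x}.indicator g x ∂μ) :=
        setLIntegral_mono' measurableSet_Ioi hlevel
    _ = N * ENNReal.ofReal (2 * q / (q - 1)) * ∫⁻ x, g x * (2 * g x) ^ (q - 1) ∂μ := by
        rw [lintegral_const_mul' _ _ (by finiteness),
          lintegral_rpow_eq_lintegral_mul_indicator μ hq' (hg.const_mul 2) hg]
    _ = _ := by
        have : ∀ x, g x * (2 * g x) ^ (q - 1) = 2 ^ (q - 1) * g x ^ q := by
          intro x
          rw [ENNReal.mul_rpow_of_nonneg _ _ hq'.le]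
          conv_rhs => rw [show q = 1 + (q - 1) by ring,
            ENNReal.rpow_add_of_nonneg (x := g x) 1 (q - 1) zero_le_one hq'.le, ENNReal.rpow_one]
          ring_nf
        simp only [this]
        rw [lintegral_const_mul _ (hg.pow_const q), ← mul_assoc]
        congr 1
        push_cast
        rw [ENNReal.coe_rpow_of_nonneg _ hq'.le]
        rfl

/-- A strictly positive, almost everywhere finite weight with `M W ≤ C W`
(a Muckenhoupt `A₁` weight). -/
structure IsA1Weight {E : Type*} [PseudoMetricSpace E] [MeasurableSpace E] (μ : Measure E)
    (C : ℝ≥0) (W : E → ℝ≥0∞) : Prop where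
  measurable : Measurable W
  ne_zero : ∀ x, W x ≠ 0
  ae_ne_top : ∀ᵐ x ∂μ, W x ≠ ∞
  maximal_le : ∀ x, dyadicMaximal μ W x ≤ C * W x

/-- The Rubio de Francia algorithm: every function in `L^q` has an `A₁` majorant of comparable
norm. -/
theorem exists_isA1Weight_ge {E : Type*} [MetricSpace E] [SecondCountableTopology E]
    [MeasurableSpace E] [OpensMeasurableSpace E] [HasBesicovitchCovering E]
    (μ : Measure E) [SigmaFinite μ] {q : ℝ} (hq : 1 < q) :
    ∃ C : ℝ≥0, ∀ g : E → ℝ≥0∞, Measurable g → ∫⁻ x, g x ^ q ∂μ ≠ ∞ →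
      ∀ ε : ℝ≥0∞, ε ≠ 0 → ε ≠ ∞ → ∃ W, IsA1Weight μ C W ∧ g ≤ W ∧
        ∫⁻ x, W x ^ q ∂μ ≤ C * (∫⁻ x, g x ^ q ∂μ + ε) := by
  obtain ⟨A₀, hA₀⟩ := exists_lintegral_dyadicMaximal_rpow_le E hq
  have hq0 : 0 < q := zero_lt_one.trans hq
  set A : ℝ≥0 := A₀ + 1 with hAdef
  have hA1 : 1 ≤ A := by simp [hAdef]
  have hA : ∀ g : E → ℝ≥0∞, Measurable g →
      ∫⁻ x, dyadicMaximal μ g x ^ q ∂μ ≤ A * ∫⁻ x, g x ^ q ∂μ := fun g hg =>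
    (hA₀ μ g hg).trans (by gcongr; simp [hAdef])
  refine ⟨4 * A + 2 ^ q * 2, fun g hg hgfin ε hε hε' => ?_⟩
  obtain ⟨φ, hφpos, hφm, hφ⟩ := exists_pos_lintegral_lt_of_sigmaFinite μ hε
  set u : E → ℝ≥0∞ := fun x => max (g x) ((φ x : ℝ≥0∞) ^ q⁻¹) with hu
  have hum : Measurable u := hg.max (hφm.coe_nnreal_ennreal.pow_const _)
  have hupos : ∀ x, 0 < u x := fun x => lt_max_of_lt_right
    (ENNReal.rpow_pos (by simpa using hφpos x) ENNReal.coe_ne_top)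
  have huint : ∫⁻ x, u x ^ q ∂μ ≤ ∫⁻ x, g x ^ q ∂μ + ε := by
    calc ∫⁻ x, u x ^ q ∂μ ≤ ∫⁻ x, (g x ^ q + φ x) ∂μ := by
          refine lintegral_mono fun x => ?_
          rcases max_cases (g x) ((φ x : ℝ≥0∞) ^ q⁻¹) with h | h
          · simp only [hu, h.1]
            exact le_self_add
          · simp only [hu, h.1]
            rw [← ENNReal.rpow_mul, inv_mul_cancel₀ hq0.ne', ENNReal.rpow_one]
            exact le_add_self
      _ = ∫⁻ x, g x ^ q ∂μ + ∫⁻ x, φ x ∂μ := lintegral_add_left (hg.pow_const q) _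
      _ ≤ _ := by gcongr
  set m : ℕ → E → ℝ≥0∞ := fun k => (dyadicMaximal μ)^[k] u with hm
  have hmsucc : ∀ k, m (k + 1) = dyadicMaximal μ (m k) := fun k =>
    Function.iterate_succ_apply' _ _ _
  have hmm : ∀ k, Measurable (m k) := by
    intro k
    induction k with
    | zero => exact hum
    | succ k ih => rw [hmsucc]; exact measurable_dyadicMaximal μ ih
  have hmint : ∀ k, ∫⁻ x, m k x ^ q ∂μ ≤ (A : ℝ≥0∞) ^ k * ∫⁻ x, u x ^ q ∂μ := by
    intro k
    induction k with
    | zero => simp [hm]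
    | succ k ih =>
      rw [hmsucc, pow_succ', mul_assoc]
      exact (hA _ (hmm k)).trans (by gcongr)
  have hA0 : (A : ℝ≥0∞) ≠ 0 := by
    simpa using (zero_lt_one.trans_le hA1).ne'
  set b : ℝ≥0∞ := (2 * A : ℝ≥0∞)⁻¹ with hb
  have hb1 : b ≤ 1 := by
    rw [hb, ENNReal.inv_le_one]
    have : (1 : ℝ≥0∞) ≤ A := by exact_mod_cast hA1
    calc (1 : ℝ≥0∞) ≤ 2 * 1 := by norm_num
      _ ≤ 2 * A := by gcongr
  have hbA : b * A = 2⁻¹ := by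
    rw [hb, ENNReal.mul_inv (by simp) (by simp), mul_assoc,
      ENNReal.inv_mul_cancel hA0 ENNReal.coe_ne_top, mul_one]
  have hgeom : ∑' k : ℕ, (2⁻¹ : ℝ≥0∞) ^ k = 2 := by
    rw [ENNReal.tsum_geometric, ENNReal.one_sub_inv_two, inv_inv]
  set W : E → ℝ≥0∞ := fun x => ∑' k, (2⁻¹ * b) ^ k * m k x with hW
  have hWm : Measurable W := Measurable.tsum fun k => (hmm k).const_mul _
  have huW : u ≤ W := fun x => by
    simpa [hm] using ENNReal.le_tsum (f := fun k => (2⁻¹ * b) ^ k * m k x) 0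
  have hterm : ∀ k, ∫⁻ x, (b ^ k * m k x) ^ q ∂μ ≤ 2⁻¹ ^ k * ∫⁻ x, u x ^ q ∂μ := by
    intro k
    calc ∫⁻ x, (b ^ k * m k x) ^ q ∂μ = (b ^ k) ^ q * ∫⁻ x, m k x ^ q ∂μ := by
          simp only [ENNReal.mul_rpow_of_nonneg _ _ hq0.le]
          rw [lintegral_const_mul _ ((hmm k).pow_const q)]
      _ ≤ b ^ k * (A ^ k * ∫⁻ x, u x ^ q ∂μ) := by
          gcongr
          · exact (ENNReal.rpow_le_rpow_of_exponent_ge (pow_le_one₀ zero_le hb1) hq.le).trans_eq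
              (ENNReal.rpow_one _)
          · exact hmint k
      _ = _ := by rw [← mul_assoc, ← mul_pow, hbA]
  have hWint : ∫⁻ x, W x ^ q ∂μ ≤ 2 ^ q * 2 * ∫⁻ x, u x ^ q ∂μ := by
    have hpt : ∀ x, W x ^ q ≤ 2 ^ q * ∑' k, (b ^ k * m k x) ^ q := by
      intro x
      set S := ∑' k, (b ^ k * m k x) ^ q
      have hWS : W x ≤ 2 * S ^ q⁻¹ := by
        rw [← hgeom, ← ENNReal.tsum_mul_right]
        refine ENNReal.tsum_le_tsum fun k => ?_
        rw [mul_pow, mul_assoc]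
        gcongr
        rw [ENNReal.le_rpow_inv_iff hq0]
        exact ENNReal.le_tsum (f := fun k => (b ^ k * m k x) ^ q) k
      calc W x ^ q ≤ (2 * S ^ q⁻¹) ^ q := by gcongr
        _ = 2 ^ q * S := by
          rw [ENNReal.mul_rpow_of_nonneg _ _ hq0.le, ← ENNReal.rpow_mul,
            inv_mul_cancel₀ hq0.ne', ENNReal.rpow_one]
    have hmb : ∀ k, Measurable fun x => (b ^ k * m k x) ^ q := fun k =>
      ((hmm k).const_mul _).pow_const q
    calc ∫⁻ x, W x ^ q ∂μ ≤ ∫⁻ x, 2 ^ q * ∑' k, (b ^ k * m k x) ^ q ∂μ := lintegral_mono hpt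
      _ = 2 ^ q * ∑' k, ∫⁻ x, (b ^ k * m k x) ^ q ∂μ := by
        rw [lintegral_const_mul _ (Measurable.tsum hmb),
          lintegral_tsum fun k => (hmb k).aemeasurable]
      _ ≤ 2 ^ q * ∑' k : ℕ, 2⁻¹ ^ k * ∫⁻ x, u x ^ q ∂μ := by
        gcongr with k
        exact hterm k
      _ = _ := by rw [ENNReal.tsum_mul_right, hgeom, mul_assoc]
  have hcast : ((4 * A + 2 ^ q * 2 : ℝ≥0) : ℝ≥0∞) = 4 * A + 2 ^ q * 2 := by
    push_cast
    rw [ENNReal.coe_rpow_of_nonneg _ hq0.le]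
    rfl
  refine ⟨W, ⟨hWm, fun x => ((hupos x).trans_le (huW x)).ne', ?_, fun x => ?_⟩,
    fun x => (le_max_left _ _).trans (huW x), ?_⟩
  · have hfin : ∫⁻ x, W x ^ q ∂μ ≠ ∞ := by
      refine ne_top_of_le_ne_top ?_ (hWint.trans (mul_le_mul_right huint _))
      exact ENNReal.mul_ne_top (ENNReal.mul_ne_top
        (ENNReal.rpow_ne_top_of_nonneg hq0.le (by simp)) (by simp))
        (ENNReal.add_ne_top.2 ⟨hgfin, hε'⟩)
    filter_upwards [ae_lt_top (hWm.pow_const q) hfin] with x hx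
    exact fun h => hx.ne (by rw [h, ENNReal.top_rpow_of_pos hq0])
  · calc dyadicMaximal μ W x ≤ ∑' k, dyadicMaximal μ (fun y => (2⁻¹ * b) ^ k * m k y) x :=
          dyadicMaximal_tsum_le μ (fun k => (hmm k).const_mul _) x
      _ = ∑' k, 4 * A * ((2⁻¹ * b) ^ (k + 1) * m (k + 1) x) := by
          congr! 2 with k
          rw [dyadicMaximal_const_mul μ _ (hmm k), hmsucc, pow_succ']
          have : 4 * A * (2⁻¹ * b) = 1 := by
            calc 4 * A * (2⁻¹ * b) = 4 * 2⁻¹ * (b * A) := by ring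
              _ = 2 * (2 * 2⁻¹) * 2⁻¹ := by rw [hbA]; ring
              _ = 1 := by
                rw [ENNReal.mul_inv_cancel (by simp) (by simp), mul_one,
                  ENNReal.mul_inv_cancel (by simp) (by simp)]
          rw [← mul_assoc (4 * (A : ℝ≥0∞)), ← mul_assoc (4 * (A : ℝ≥0∞)), this, one_mul]
      _ ≤ 4 * A * W x := by
          rw [ENNReal.tsum_mul_left]
          gcongr
          exact ENNReal.tsum_comp_le_tsum_of_injective (add_left_injective 1)
            fun k => (2⁻¹ * b) ^ k * m k x
      _ ≤ _ := by
          rw [hcast]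
          gcongr
          exact le_self_add
  · rw [hcast]
    calc _ ≤ _ := hWint
      _ ≤ _ := by
        gcongr
        exact le_add_self

theorem IsA1Weight.setLIntegral_ne_zero {E : Type*} [PseudoMetricSpace E] [MeasurableSpace E]
    {μ : Measure E} [μ.IsOpenPosMeasure] {C : ℝ≥0} {W : E → ℝ≥0∞} (hW : IsA1Weight μ C W)
    (x : E) (k : ℤ) :
    ∫⁻ z in closedBall x ((2 : ℝ) ^ k), W z ∂μ ≠ 0 := by
  refine (setLIntegral_pos_iff hW.measurable |>.2 ?_).ne'
  have : Function.support W = Set.univ := Set.eq_univ_of_forall hW.ne_zero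
  rw [this, Set.univ_inter]
  exact measure_closedBall_pos μ x (by positivity)

section AddHaar

variable {E : Type*} [NormedAddCommGroup E] [NormedSpace ℝ E] [FiniteDimensional ℝ E]
  [MeasurableSpace E] [BorelSpace E] (μ : Measure E) [μ.IsAddHaarMeasure]

theorem addHaar_closedBall_two_mul (x y : E) {r : ℝ} (hr : 0 ≤ r) :
    μ (closedBall y (2 * r)) = 2 ^ Module.finrank ℝ E * μ (closedBall x r) := by
  rw [Measure.addHaar_closedBall_mul μ y zero_le_two hr, Measure.addHaar_closedBall_center μ x]
  congr 1
  rw [ENNReal.ofReal_pow zero_le_two]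
  simp

variable {μ} {C : ℝ≥0} {W : E → ℝ≥0∞}

theorem IsA1Weight.setLIntegral_le (hW : IsA1Weight μ C W) {x y : E} {k : ℤ}
    (hy : y ∈ closedBall x ((2 : ℝ) ^ k)) :
    ∫⁻ z in closedBall x ((2 : ℝ) ^ k), W z ∂μ ≤
      (2 ^ Module.finrank ℝ E * C) * μ (closedBall x ((2 : ℝ) ^ k)) * W y := by
  have h2 : (2 : ℝ) ^ (k + 1) = 2 * (2 : ℝ) ^ k := by rw [zpow_add_one₀ two_ne_zero, mul_comm]
  have hsub : closedBall x ((2 : ℝ) ^ k) ⊆ closedBall y ((2 : ℝ) ^ (k + 1)) := by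
    refine closedBall_subset_closedBall' ?_
    rw [h2, dist_comm]
    linarith [mem_closedBall.1 hy]
  have hpos : (0 : ℝ) < 2 ^ (k + 1) := by positivity
  have h := (average_le_dyadicMaximal μ W y (k + 1)).trans (hW.maximal_le y)
  rw [ENNReal.inv_mul_le_iff (measure_closedBall_pos μ y hpos).ne' measure_closedBall_lt_top.ne,
    h2, addHaar_closedBall_two_mul μ x y (by positivity), ← h2] at h
  calc _ ≤ _ := lintegral_mono_set hsub
    _ ≤ _ := h
    _ = _ := by ring

theorem IsA1Weight.setLIntegral_ne_top (hW : IsA1Weight μ C W) (x : E) (k : ℤ) :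
    ∫⁻ z in closedBall x ((2 : ℝ) ^ k), W z ∂μ ≠ ∞ := by
  have hpos : μ (closedBall x ((2 : ℝ) ^ k)) ≠ 0 :=
    (measure_closedBall_pos μ x (by positivity)).ne'
  obtain ⟨y, hy, hyW⟩ : ∃ y ∈ closedBall x ((2 : ℝ) ^ k), W y ≠ ∞ := by
    by_contra! h
    exact hpos (measure_mono_null (fun y hy => by simpa using h y hy) (ae_iff.1 hW.ae_ne_top))
  refine ne_top_of_le_ne_top ?_ (hW.setLIntegral_le hy)
  have := (measure_closedBall_lt_top (μ := μ) (x := x) (r := (2 : ℝ) ^ k)).ne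
  finiteness

/-- An `A₁` weight controls the unweighted maximal function by the weighted one. -/
theorem IsA1Weight.dyadicMaximal_le (hW : IsA1Weight μ C W) {f : E → ℝ≥0∞} (hf : Measurable f)
    (x : E) :
    dyadicMaximal μ f x ≤
      (2 ^ Module.finrank ℝ E * C) * dyadicMaximal (μ.withDensity W) f x := by
  refine iSup_le fun k => ?_
  refine le_trans ?_ (mul_le_mul_right (average_le_dyadicMaximal (μ.withDensity W) f x k) _)
  rw [withDensity_apply _ measurableSet_closedBall,
    setLIntegral_withDensity_eq_setLIntegral_mul μ hW.measurable hf measurableSet_closedBall]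
  have hV0 := hW.setLIntegral_ne_zero x k
  have hVt := hW.setLIntegral_ne_top x k
  have hpos : μ (closedBall x ((2 : ℝ) ^ k)) ≠ 0 :=
    (measure_closedBall_pos μ x (by positivity)).ne'
  rw [ENNReal.inv_mul_le_iff hpos measure_closedBall_lt_top.ne]
  set B := closedBall x ((2 : ℝ) ^ k)
  set V := ∫⁻ z in B, W z ∂μ
  set D : ℝ≥0∞ := 2 ^ Module.finrank ℝ E * C
  have hmain : V * ∫⁻ y in B, f y ∂μ ≤ D * μ B * ∫⁻ y in B, (W * f) y ∂μ := by
    rw [← lintegral_const_mul _ hf, ← lintegral_const_mul _ (hW.measurable.mul hf)]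
    refine setLIntegral_mono' measurableSet_closedBall fun y hy => ?_
    rw [Pi.mul_apply, ← mul_assoc]
    exact mul_le_mul_left (hW.setLIntegral_le hy) _
  calc ∫⁻ y in B, f y ∂μ = V⁻¹ * (V * ∫⁻ y in B, f y ∂μ) := by
        rw [← mul_assoc, ENNReal.inv_mul_cancel hV0 hVt, one_mul]
    _ ≤ V⁻¹ * (D * μ B * ∫⁻ y in B, (W * f) y ∂μ) := by gcongr
    _ = _ := by ring

theorem IsA1Weight.dyadicMaximal_le_mul (hW : IsA1Weight μ C W) {f : E → ℝ≥0∞}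
    (hf : Measurable f) (x : E) :
    dyadicMaximal μ f x ≤
      C * W x * dyadicMaximal (μ.withDensity W) (fun y => (W y)⁻¹ * f y) x := by
  have hg : Measurable fun y => (W y)⁻¹ * f y := hW.measurable.inv.mul hf
  refine iSup_le fun k => ?_
  refine le_trans ?_ (mul_le_mul' ((average_le_dyadicMaximal μ W x k).trans (hW.maximal_le x))
    (average_le_dyadicMaximal (μ.withDensity W) (fun y => (W y)⁻¹ * f y) x k))
  rw [withDensity_apply _ measurableSet_closedBall,
    setLIntegral_withDensity_eq_setLIntegral_mul μ hW.measurable hg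
      measurableSet_closedBall]
  have hV0 := hW.setLIntegral_ne_zero x k
  have hVt := hW.setLIntegral_ne_top x k
  set B := closedBall x ((2 : ℝ) ^ k)
  set V := ∫⁻ z in B, W z ∂μ
  have hf' : ∫⁻ y in B, f y ∂μ = ∫⁻ y in B, (W * fun y => (W y)⁻¹ * f y) y ∂μ := by
    refine lintegral_congr_ae (ae_restrict_of_ae ?_)
    filter_upwards [hW.ae_ne_top] with y hy
    rw [Pi.mul_apply, ← mul_assoc, ENNReal.mul_inv_cancel (hW.ne_zero y) hy, one_mul]
  rw [hf', mul_assoc, ← mul_assoc V, ENNReal.mul_inv_cancel hV0 hVt, one_mul]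

variable (μ C) in
/-- The maximal function is bounded on `L²(W)` for an `A₁` weight `W`. -/
theorem exists_lintegral_weight_mul_dyadicMaximal_sq_le :
    ∃ K : ℝ≥0, ∀ W : E → ℝ≥0∞, IsA1Weight μ C W → ∀ f : E → ℝ≥0∞, Measurable f →
      ∫⁻ x, W x * dyadicMaximal μ f x ^ 2 ∂μ ≤ K * ∫⁻ x, W x * f x ^ 2 ∂μ := by
  obtain ⟨K, hK⟩ := exists_lintegral_dyadicMaximal_rpow_le E one_lt_two
  simp only [ENNReal.rpow_two] at hK
  refine ⟨(2 ^ Module.finrank ℝ E * C) ^ 2 * K, fun W hW f hf => ?_⟩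
  have hν : ∀ g : E → ℝ≥0∞, Measurable g →
      ∫⁻ x, g x ∂μ.withDensity W = ∫⁻ x, W x * g x ∂μ := fun g hg =>
    lintegral_withDensity_eq_lintegral_mul μ hW.measurable hg
  rw [← hν _ ((measurable_dyadicMaximal μ hf).pow_const 2), ← hν _ (hf.pow_const 2)]
  push_cast
  calc _ ≤ ∫⁻ x, (2 ^ Module.finrank ℝ E * C) ^ 2 *
          dyadicMaximal (μ.withDensity W) f x ^ 2 ∂μ.withDensity W := by
        gcongr with x
        rw [← mul_pow]
        gcongr
        exact hW.dyadicMaximal_le hf x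
    _ ≤ _ := by
        rw [lintegral_const_mul _ ((measurable_dyadicMaximal _ hf).pow_const 2), mul_assoc]
        gcongr
        exact hK _ f hf

variable (μ C) in
/-- The maximal function is bounded on `L²(W⁻¹)` for an `A₁` weight `W`. -/
theorem exists_lintegral_inv_weight_mul_dyadicMaximal_sq_le :
    ∃ K : ℝ≥0, ∀ W : E → ℝ≥0∞, IsA1Weight μ C W → ∀ f : E → ℝ≥0∞, Measurable f →
      ∫⁻ x, (W x)⁻¹ * dyadicMaximal μ f x ^ 2 ∂μ ≤ K * ∫⁻ x, (W x)⁻¹ * f x ^ 2 ∂μ := by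
  obtain ⟨K, hK⟩ := exists_lintegral_dyadicMaximal_rpow_le E one_lt_two
  simp only [ENNReal.rpow_two] at hK
  refine ⟨C ^ 2 * K, fun W hW f hf => ?_⟩
  have hg : Measurable fun y => (W y)⁻¹ * f y := hW.measurable.inv.mul hf
  have hMg := measurable_dyadicMaximal (μ.withDensity W) hg
  have hν : ∀ g : E → ℝ≥0∞, Measurable g →
      ∫⁻ x, g x ∂μ.withDensity W = ∫⁻ x, W x * g x ∂μ := fun g hg =>
    lintegral_withDensity_eq_lintegral_mul μ hW.measurable hg
  push_cast
  calc _ ≤ ∫⁻ x, C ^ 2 * (W x *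
          dyadicMaximal (μ.withDensity W) (fun y => (W y)⁻¹ * f y) x ^ 2) ∂μ := by
        refine lintegral_mono_ae ?_
        filter_upwards [hW.ae_ne_top] with x hx
        calc _ ≤ (W x)⁻¹ * (C * W x *
              dyadicMaximal (μ.withDensity W) (fun y => (W y)⁻¹ * f y) x) ^ 2 := by
              gcongr
              exact hW.dyadicMaximal_le_mul hf x
          _ = (W x)⁻¹ * W x * (C ^ 2 * (W x *
              dyadicMaximal (μ.withDensity W) (fun y => (W y)⁻¹ * f y) x ^ 2)) := by ring
          _ = _ := by rw [ENNReal.inv_mul_cancel (hW.ne_zero x) hx, one_mul]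
    _ ≤ C ^ 2 * (K * ∫⁻ x, ((W x)⁻¹ * f x) ^ 2 ∂μ.withDensity W) := by
        have hm : Measurable fun x => W x *
            dyadicMaximal (μ.withDensity W) (fun y => (W y)⁻¹ * f y) x ^ 2 :=
          hW.measurable.mul (hMg.pow_const 2)
        rw [lintegral_const_mul _ hm, ← hν _ (hMg.pow_const 2)]
        gcongr
        exact hK _ _ hg
    _ = _ := by
        rw [hν _ (hg.pow_const 2), mul_assoc]
        congr 2
        refine lintegral_congr_ae ?_
        filter_upwards [hW.ae_ne_top] with x hx
        calc W x * ((W x)⁻¹ * f x) ^ 2 = W x * (W x)⁻¹ * ((W x)⁻¹ * f x ^ 2) := by ring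
          _ = _ := by rw [ENNReal.mul_inv_cancel (hW.ne_zero x) hx, one_mul]

end AddHaar

theorem le_mul_of_forall_le_mul_add {x a : ℝ≥0∞} {C : ℝ≥0} (hC : C ≠ 0)
    (h : ∀ ε : ℝ≥0∞, ε ≠ 0 → ε ≠ ∞ → x ≤ C * (a + ε)) : x ≤ C * a := by
  refine ENNReal.le_of_forall_pos_le_add fun ε hε _ => ?_
  refine (h (ε / C) (by simp [hε.ne']) (ENNReal.div_ne_top (by simp) (by simpa))).trans ?_
  rw [mul_add]
  gcongr
  exact ENNReal.mul_div_le

/-- The converse of Hölder's inequality. -/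
theorem lintegral_rpow_le_of_forall_lintegral_mul_le {α : Type*} [MeasurableSpace α]
    {μ : Measure α} [SigmaFinite μ] {r q : ℝ} (hrq : r.HolderConjugate q) {G : α → ℝ≥0∞}
    (hG : Measurable G) {D : ℝ≥0∞}
    (h : ∀ w : α → ℝ≥0∞, Measurable w → ∫⁻ x, w x ^ q ∂μ ≠ ∞ →
      ∫⁻ x, w x * G x ∂μ ≤ D * (∫⁻ x, w x ^ q ∂μ) ^ (1 / q)) :
    ∫⁻ x, G x ^ r ∂μ ≤ D ^ r := by
  have hr := hrq.pos
  have hr1 := hrq.sub_one_pos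
  have hq := hrq.symm.pos
  set S := spanningSets μ
  have hS := measurableSet_spanningSets μ
  have hmin : ∀ k : ℕ, Measurable fun x => min (G x) k := fun k => hG.min measurable_const
  have htrunc : ∀ k : ℕ, ∫⁻ x, (S k).indicator (fun x => min (G x) k ^ r) x ∂μ ≤ D ^ r := by
    intro k
    set w : α → ℝ≥0∞ := (S k).indicator fun x => min (G x) k ^ (r - 1) with hw
    have hwm : Measurable w := ((hmin k).pow_const _).indicator (hS k)
    have hwq : ∀ x, w x ^ q = (S k).indicator (fun x => min (G x) k ^ r) x := by
      intro x
      by_cases hx : x ∈ S k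
      · simp only [hw, Set.indicator_of_mem hx]
        rw [← ENNReal.rpow_mul, hrq.sub_one_mul_conj]
      · simp [hw, hx, hq]
    have hwG : ∀ x, w x ^ q ≤ w x * G x := by
      intro x
      rw [hwq]
      by_cases hx : x ∈ S k
      · simp only [hw, Set.indicator_of_mem hx]
        calc min (G x) k ^ r = min (G x) k ^ (r - 1) * min (G x) k := by
              conv_lhs => rw [← sub_add_cancel r 1,
                ENNReal.rpow_add_of_nonneg _ _ hr1.le zero_le_one, ENNReal.rpow_one]
          _ ≤ _ := by gcongr; exact min_le_left _ _
      · simp [hx]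
    simp only [← hwq]
    set X := ∫⁻ x, w x ^ q ∂μ with hX
    have hXtop : X ≠ ∞ := by
      refine ne_top_of_le_ne_top (b := (k : ℝ≥0∞) ^ r * μ (S k)) ?_ ?_
      · exact ENNReal.mul_ne_top (ENNReal.rpow_ne_top_of_nonneg hr.le (by simp))
          (measure_spanningSets_lt_top μ k).ne
      · simp only [hX, hwq]
        rw [lintegral_indicator (hS k), ← setLIntegral_const]
        gcongr
        exact min_le_right _ _
    have hle : X ≤ D * X ^ (1 / q) := (lintegral_mono hwG).trans (h w hwm hXtop)
    rcases eq_or_ne X 0 with hX0 | hX0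
    · simp [hX0]
    have hpow0 : X ^ (1 / q) ≠ 0 := by simp [hX0, hXtop]
    have hpowt : X ^ (1 / q) ≠ ∞ := ENNReal.rpow_ne_top_of_nonneg (by positivity) hXtop
    have hsplit : X = X ^ (1 / r) * X ^ (1 / q) := by
      rw [← ENNReal.rpow_add _ _ hX0 hXtop, one_div, one_div, hrq.inv_add_inv_eq_one,
        ENNReal.rpow_one]
    have hroot : X ^ (1 / r) ≤ D := by
      rw [← ENNReal.mul_le_mul_iff_left hpow0 hpowt, ← hsplit]
      exact hle
    rwa [one_div, ENNReal.rpow_inv_le_iff hr] at hroot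
  refine le_of_tendsto' (lintegral_tendsto_of_tendsto_of_monotone
    (fun k => (((hmin k).pow_const r).indicator (hS k)).aemeasurable) ?_ ?_) htrunc
  · refine Filter.Eventually.of_forall fun x j k hjk => ?_
    refine (Set.indicator_le_indicator_of_subset (monotone_spanningSets μ hjk)
      (fun _ => zero_le) x).trans (Set.indicator_le_indicator ?_)
    gcongr
  · refine Filter.Eventually.of_forall fun x => ?_
    have hlim : Filter.Tendsto (fun k : ℕ => min (G x) (k : ℝ≥0∞) ^ r) Filter.atTop
        (nhds (G x ^ r)) := by
      have := (tendsto_const_nhds (x := G x)).min ENNReal.tendsto_nat_nhds_top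
      rw [min_eq_left le_top] at this
      exact (ENNReal.continuous_rpow_const.tendsto _).comp this
    refine hlim.congr' ?_
    filter_upwards [Filter.eventually_ge_atTop (spanningSetsIndex μ x)] with k hk
    rw [Set.indicator_of_mem (mem_spanningSets_of_index_le μ x hk)]

section VectorValued

variable {T E : Type*} [MeasurableSpace T] {ν : Measure T} [SFinite ν] [NormedAddCommGroup E]
  [NormedSpace ℝ E] [FiniteDimensional ℝ E] [MeasurableSpace E] [BorelSpace E] {μ : Measure E}
  [μ.IsAddHaarMeasure]

theorem lintegral_mul_lintegral_dyadicMaximal_sq_le {K : ℝ≥0} {v : E → ℝ≥0∞} (hv : Measurable v)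
    (hK : ∀ g : E → ℝ≥0∞, Measurable g →
      ∫⁻ x, v x * dyadicMaximal μ g x ^ 2 ∂μ ≤ K * ∫⁻ x, v x * g x ^ 2 ∂μ)
    {f : T → E → ℝ≥0∞} (hf : Measurable (Function.uncurry f)) :
    ∫⁻ x, v x * ∫⁻ t, dyadicMaximal μ (f t) x ^ 2 ∂ν ∂μ ≤
      K * ∫⁻ x, v x * ∫⁻ t, f t x ^ 2 ∂ν ∂μ := by
  have hswap : ∀ a : T → E → ℝ≥0∞, Measurable (Function.uncurry a) →
      ∫⁻ x, v x * ∫⁻ t, a t x ∂ν ∂μ = ∫⁻ t, ∫⁻ x, v x * a t x ∂μ ∂ν := by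
    intro a ha
    rw [lintegral_lintegral_swap
      ((hv.comp measurable_snd).mul ha : Measurable (Function.uncurry fun t x =>
        v x * a t x)).aemeasurable]
    refine lintegral_congr fun x => ?_
    exact (lintegral_const_mul _ (ha.comp measurable_prodMk_right)).symm
  have hM : Measurable (Function.uncurry fun t x => dyadicMaximal μ (f t) x ^ 2) :=
    (measurable_dyadicMaximal_uncurry μ hf).pow_const 2
  rw [hswap _ hM, hswap _ (hf.pow_const 2), ← lintegral_const_mul' _ _ ENNReal.coe_ne_top]
  exact lintegral_mono fun t => hK _ (hf.comp measurable_prodMk_left)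

variable (ν μ) in
theorem exists_lintegral_sqFunction_dyadicMaximal_le_of_lt_two {p : ℝ} (hp : 1 < p)
    (hp2 : p < 2) :
    ∃ C : ℝ≥0∞, C ≠ ∞ ∧ ∀ f : T → E → ℝ≥0∞, Measurable (Function.uncurry f) →
      ∫⁻ x, (∫⁻ t, dyadicMaximal μ (f t) x ^ 2 ∂ν) ^ (p / 2) ∂μ ≤
        C * ∫⁻ x, (∫⁻ t, f t x ^ 2 ∂ν) ^ (p / 2) ∂μ := by
  have h2p : 0 < 2 - p := by linarith
  have hq : 1 < p / (2 - p) := by rw [one_lt_div h2p]; linarith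
  obtain ⟨C, hC⟩ := exists_isA1Weight_ge μ hq
  obtain ⟨K, hK⟩ := exists_lintegral_inv_weight_mul_dyadicMaximal_sq_le μ C
  refine ⟨(K + C + 1 : ℝ≥0), by simp, fun f hf => ?_⟩
  set G : E → ℝ≥0∞ := fun x => ∫⁻ t, dyadicMaximal μ (f t) x ^ 2 ∂ν with hGdef
  set S : E → ℝ≥0∞ := fun x => ∫⁻ t, f t x ^ 2 ∂ν with hSdef
  have hG : Measurable G :=
    Measurable.lintegral_prod_left' ((measurable_dyadicMaximal_uncurry μ hf).pow_const 2)
  have hS : Measurable S := Measurable.lintegral_prod_left' (hf.pow_const 2)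
  refine le_mul_of_forall_le_mul_add (by positivity) fun ε hε hε' => ?_
  set a := ∫⁻ x, S x ^ (p / 2) ∂μ with ha
  rcases eq_or_ne a ∞ with hatop | hatop
  · rw [hatop, top_add, ENNReal.mul_top (by simp)]
    exact le_top
  have hSq : ∀ x, (S x ^ ((2 - p) / 2)) ^ (p / (2 - p)) = S x ^ (p / 2) := fun x => by
    rw [← ENNReal.rpow_mul]
    congr 1
    field_simp
  obtain ⟨W, hW, hSW, hWint⟩ := hC (fun x => S x ^ ((2 - p) / 2)) (hS.pow_const _)
    (by simpa only [hSq] using hatop) ε hε hε'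
  simp only [hSq] at hWint
  have hWS : ∀ x, (W x)⁻¹ * S x ≤ S x ^ (p / 2) := by
    intro x
    calc (W x)⁻¹ * S x ≤ (S x ^ ((2 - p) / 2))⁻¹ * S x := by
          gcongr
          exact hSW x
      _ = (S x ^ ((2 - p) / 2))⁻¹ * S x ^ ((2 - p) / 2) * S x ^ (p / 2) := by
          rw [mul_assoc, ← ENNReal.rpow_add_of_nonneg _ _ (by positivity) (by positivity),
            show (2 - p) / 2 + p / 2 = 1 by ring, ENNReal.rpow_one]
      _ ≤ _ := mul_le_of_le_one_left' (ENNReal.inv_mul_le_one _)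
  have hGW : ∫⁻ x, (W x)⁻¹ * G x ∂μ ≤ K * a :=
    (lintegral_mul_lintegral_dyadicMaximal_sq_le hW.measurable.inv (hK W hW) hf).trans
      (mul_le_mul_right (lintegral_mono hWS) _)
  have hconj : (2 / p).HolderConjugate (2 / (2 - p)) := by
    rw [Real.holderConjugate_iff]
    refine ⟨by rw [one_lt_div (by positivity)]; exact hp2, ?_⟩
    field_simp
    ring
  have hholder := ENNReal.lintegral_mul_le_Lp_mul_Lq μ hconj
    (f := fun x => ((W x)⁻¹ * G x) ^ (p / 2)) (g := fun x => W x ^ (p / 2))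
    ((hW.measurable.inv.mul hG).pow_const _).aemeasurable
    (hW.measurable.pow_const _).aemeasurable
  have hp1 : p / 2 * (2 / p) = 1 := by field_simp
  have hp3 : p / 2 * (2 / (2 - p)) = p / (2 - p) := by field_simp
  simp only [Pi.mul_apply, ← ENNReal.rpow_mul, hp1, hp3, ENNReal.rpow_one, one_div_div] at hholder
  set R : ℝ≥0∞ := ((K + C + 1 : ℝ≥0) : ℝ≥0∞) * (a + ε)
  calc ∫⁻ x, G x ^ (p / 2) ∂μ
      = ∫⁻ x, ((W x)⁻¹ * G x) ^ (p / 2) * W x ^ (p / 2) ∂μ := by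
        refine lintegral_congr_ae ?_
        filter_upwards [hW.ae_ne_top] with x hx
        rw [← ENNReal.mul_rpow_of_nonneg _ _ (by positivity), mul_right_comm,
          ENNReal.inv_mul_cancel (hW.ne_zero x) hx, one_mul]
    _ ≤ _ := hholder
    _ ≤ R ^ (p / 2) * R ^ ((2 - p) / 2) := by
        gcongr
        · refine hGW.trans ?_
          refine mul_le_mul' ?_ le_self_add
          exact_mod_cast (by rw [add_assoc]; exact le_self_add : K ≤ K + C + 1)
        · refine hWint.trans ?_
          refine mul_le_mul_left ?_ _
          exact_mod_cast (by rw [add_right_comm]; exact le_add_self : C ≤ K + C + 1)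
    _ = R := by
        rw [← ENNReal.rpow_add_of_nonneg _ _ (by positivity) (by positivity),
          show p / 2 + (2 - p) / 2 = 1 by ring, ENNReal.rpow_one]

variable (ν μ) in
theorem exists_lintegral_sqFunction_dyadicMaximal_le_of_two_lt {p : ℝ} (hp : 2 < p) :
    ∃ C : ℝ≥0∞, C ≠ ∞ ∧ ∀ f : T → E → ℝ≥0∞, Measurable (Function.uncurry f) →
      ∫⁻ x, (∫⁻ t, dyadicMaximal μ (f t) x ^ 2 ∂ν) ^ (p / 2) ∂μ ≤
        C * ∫⁻ x, (∫⁻ t, f t x ^ 2 ∂ν) ^ (p / 2) ∂μ := by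
  set r := p / 2
  have hr : 1 < r := by rw [one_lt_div two_pos]; exact hp
  have hr0 : 0 < r := zero_lt_one.trans hr
  set q := r.conjExponent
  have hrq : r.HolderConjugate q := Real.HolderConjugate.conjExponent hr
  have hq := hrq.symm.pos
  obtain ⟨C, hC⟩ := exists_isA1Weight_ge μ hrq.symm.lt
  obtain ⟨K, hK⟩ := exists_lintegral_weight_mul_dyadicMaximal_sq_le μ C
  refine ⟨(K * (C * 2 : ℝ≥0∞) ^ (1 / q)) ^ r, ?_, fun f hf => ?_⟩
  · exact ENNReal.rpow_ne_top_of_nonneg hr0.le (ENNReal.mul_ne_top (by simp)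
      (ENNReal.rpow_ne_top_of_nonneg (by positivity) (by finiteness)))
  set G : E → ℝ≥0∞ := fun x => ∫⁻ t, dyadicMaximal μ (f t) x ^ 2 ∂ν with hGdef
  set S : E → ℝ≥0∞ := fun x => ∫⁻ t, f t x ^ 2 ∂ν with hSdef
  have hG : Measurable G :=
    Measurable.lintegral_prod_left' ((measurable_dyadicMaximal_uncurry μ hf).pow_const 2)
  have hS : Measurable S := Measurable.lintegral_prod_left' (hf.pow_const 2)
  set a := ∫⁻ x, S x ^ r ∂μ with ha
  have hroot : (a ^ (1 / r)) ^ r = a := by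
    rw [← ENNReal.rpow_mul, one_div, inv_mul_cancel₀ hr0.ne', ENNReal.rpow_one]
  rw [← hroot, ← ENNReal.mul_rpow_of_nonneg _ _ hr0.le]
  refine lintegral_rpow_le_of_forall_lintegral_mul_le hrq hG fun w hw hwfin => ?_
  set X := ∫⁻ x, w x ^ q ∂μ with hX
  rcases eq_or_ne X 0 with hX0 | hX0
  · have hw0 : ∀ᵐ x ∂μ, w x * G x = 0 := by
      filter_upwards [(lintegral_eq_zero_iff (hw.pow_const q)).1 hX0] with x hx
      have : w x = 0 := (ENNReal.rpow_eq_zero_iff_of_pos hq).1 hx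
      rw [this, zero_mul]
    rw [lintegral_congr_ae hw0, lintegral_zero]
    exact zero_le
  obtain ⟨W, hW, hwW, hWint⟩ := hC w hw hwfin X hX0 hwfin
  calc ∫⁻ x, w x * G x ∂μ ≤ ∫⁻ x, W x * G x ∂μ :=
        lintegral_mono fun x => mul_le_mul_left (hwW x) _
    _ ≤ K * ∫⁻ x, W x * S x ∂μ :=
        lintegral_mul_lintegral_dyadicMaximal_sq_le hW.measurable (hK W hW) hf
    _ ≤ K * ((∫⁻ x, W x ^ q ∂μ) ^ (1 / q) * a ^ (1 / r)) := by
        gcongr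
        exact ENNReal.lintegral_mul_le_Lp_mul_Lq μ hrq.symm hW.measurable.aemeasurable
          hS.aemeasurable
    _ ≤ K * ((C * (X + X)) ^ (1 / q) * a ^ (1 / r)) := by gcongr
    _ = _ := by
        rw [← two_mul, ← mul_assoc (C : ℝ≥0∞), ENNReal.mul_rpow_of_nonneg _ _ (by positivity)]
        ring

variable (ν μ) in
/-- The Fefferman–Stein inequality with values in `L²(ν)`. -/
theorem exists_lintegral_sqFunction_dyadicMaximal_le {p : ℝ} (hp : 1 < p) :
    ∃ C : ℝ≥0∞, C ≠ ∞ ∧ ∀ f : T → E → ℝ≥0∞, Measurable (Function.uncurry f) →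
      ∫⁻ x, (∫⁻ t, dyadicMaximal μ (f t) x ^ 2 ∂ν) ^ (p / 2) ∂μ ≤
        C * ∫⁻ x, (∫⁻ t, f t x ^ 2 ∂ν) ^ (p / 2) ∂μ := by
  rcases lt_trichotomy p 2 with h | rfl | h
  · exact exists_lintegral_sqFunction_dyadicMaximal_le_of_lt_two ν μ hp h
  · obtain ⟨K, hK⟩ := exists_lintegral_dyadicMaximal_rpow_le E one_lt_two
    simp only [ENNReal.rpow_two] at hK
    refine ⟨K, by simp, fun f hf => ?_⟩
    have := lintegral_mul_lintegral_dyadicMaximal_sq_le (ν := ν) (μ := μ) (K := K)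
      (measurable_const (a := (1 : ℝ≥0∞))) (fun g hg => by simpa using hK μ g hg) hf
    simpa using this
  · exact exists_lintegral_sqFunction_dyadicMaximal_le_of_two_lt ν μ h

end VectorValued

theorem hlMaximal_le_dyadicMaximal {n : ℕ} (f : EuclideanSpace ℝ (Fin n) → ℂ)
    (x : EuclideanSpace ℝ (Fin n)) :
    hlMaximal f x ≤ 2 ^ n * dyadicMaximal volume (fun y => (‖f y‖₊ : ℝ≥0∞)) x := by
  refine iSup₂_le fun r hr => ?_
  obtain ⟨k, hk, hk'⟩ := exists_mem_Ioc_zpow hr one_lt_two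
  refine le_trans ?_ (mul_le_mul_right (average_le_dyadicMaximal volume _ x (k + 1)) _)
  have h2 : (2 : ℝ) ^ (k + 1) = 2 * (2 : ℝ) ^ k := by rw [zpow_add_one₀ two_ne_zero, mul_comm]
  have hvol : (volume (ball x r))⁻¹ ≤ 2 ^ n * (volume (closedBall x ((2 : ℝ) ^ (k + 1))))⁻¹ := by
    rw [h2, addHaar_closedBall_two_mul volume x x (by positivity), finrank_euclideanSpace_fin,
      ENNReal.mul_inv (by simp) (by simp), ← mul_assoc,
      ENNReal.mul_inv_cancel (by simp) (by simp), one_mul]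
    gcongr
    exact closedBall_subset_ball hk
  rw [← mul_assoc]
  exact mul_le_mul' hvol
    (lintegral_mono_set (ball_subset_closedBall.trans (closedBall_subset_closedBall hk')))

theorem stmt18 (n : ℕ) (hn : 1 ≤ n) (p : ℝ) (hp : 1 < p) :
    ∃ C > (0:ℝ), ∀ F : ℝ → EuclideanSpace ℝ (Fin n) → ℂ,
      Measurable (Function.uncurry F) →
      (∫⁻ t in Set.Ioi (0:ℝ),
          (eLpNorm (F t) (ENNReal.ofReal p) volume)^2 * ENNReal.ofReal t⁻¹) < ⊤ →
      (∫⁻ x : EuclideanSpace ℝ (Fin n),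
          (∫⁻ t in Set.Ioi (0:ℝ), (hlMaximal (F t) x)^2 * ENNReal.ofReal t⁻¹) ^ (p/2)) ^ (1/p)
        ≤ ENNReal.ofReal C *
          (∫⁻ x : EuclideanSpace ℝ (Fin n),
            (∫⁻ t in Set.Ioi (0:ℝ),
              ((‖F t x‖₊ : ℝ≥0∞))^2 * ENNReal.ofReal t⁻¹) ^ (p/2)) ^ (1/p) := by
  have hp0 : 0 < p := zero_lt_one.trans hp
  have hd : Measurable fun t : ℝ => ENNReal.ofReal t⁻¹ := by fun_prop
  set ν : Measure ℝ := (volume.restrict (Set.Ioi (0 : ℝ))).withDensity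
    fun t => ENNReal.ofReal t⁻¹ with hν
  have hνint : ∀ a : ℝ → ℝ≥0∞, Measurable a →
      ∫⁻ t in Set.Ioi (0 : ℝ), a t * ENNReal.ofReal t⁻¹ = ∫⁻ t, a t ∂ν := by
    intro a ha
    rw [hν, lintegral_withDensity_eq_lintegral_mul _ hd ha]
    simp only [Pi.mul_apply, mul_comm]
  obtain ⟨C, hCtop, hC⟩ := exists_lintegral_sqFunction_dyadicMaximal_le ν
    (volume : Measure (EuclideanSpace ℝ (Fin n))) hp
  set A : ℝ≥0∞ := ((2 ^ n) ^ 2) ^ (p / 2) * C with hA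
  have hAtop : A ^ (1 / p) ≠ ∞ := by
    refine ENNReal.rpow_ne_top_of_nonneg (by positivity) (ENNReal.mul_ne_top ?_ hCtop)
    exact ENNReal.rpow_ne_top_of_nonneg (by positivity) (by finiteness)
  refine ⟨(A ^ (1 / p)).toReal + 1, by positivity, fun F hF _ => ?_⟩
  have hf : Measurable (Function.uncurry fun t x => (‖F t x‖₊ : ℝ≥0∞)) := hF.enorm
  have hfsec : ∀ x, Measurable fun t => (‖F t x‖₊ : ℝ≥0∞) ^ 2 := fun x =>
    (hf.comp measurable_prodMk_right).pow_const 2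
  have hMsec : ∀ x, Measurable fun t =>
      dyadicMaximal volume (fun y => (‖F t y‖₊ : ℝ≥0∞)) x ^ 2 := fun x =>
    ((measurable_dyadicMaximal_uncurry volume hf).comp measurable_prodMk_right).pow_const 2
  have hpt : ∀ x, ∫⁻ t in Set.Ioi (0 : ℝ), hlMaximal (F t) x ^ 2 * ENNReal.ofReal t⁻¹ ≤
      (2 ^ n) ^ 2 * ∫⁻ t, dyadicMaximal volume (fun y => (‖F t y‖₊ : ℝ≥0∞)) x ^ 2 ∂ν := by
    intro x
    rw [← hνint _ (hMsec x), ← lintegral_const_mul' _ _ (by finiteness)]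
    refine lintegral_mono fun t => ?_
    rw [← mul_assoc, ← mul_pow]
    gcongr
    exact hlMaximal_le_dyadicMaximal (F t) x
  simp only [hνint _ (hfsec _)]
  calc _ ≤ (A * ∫⁻ x, (∫⁻ t, (‖F t x‖₊ : ℝ≥0∞) ^ 2 ∂ν) ^ (p / 2)) ^ (1 / p) := by
        gcongr
        calc _ ≤ ∫⁻ x, ((2 ^ n) ^ 2 * ∫⁻ t, dyadicMaximal volume
              (fun y => (‖F t y‖₊ : ℝ≥0∞)) x ^ 2 ∂ν) ^ (p / 2) := by
              gcongr with x
              exact hpt x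
          _ = ((2 ^ n) ^ 2) ^ (p / 2) * ∫⁻ x, (∫⁻ t, dyadicMaximal volume
              (fun y => (‖F t y‖₊ : ℝ≥0∞)) x ^ 2 ∂ν) ^ (p / 2) := by
              simp only [ENNReal.mul_rpow_of_nonneg _ _ (by positivity : 0 ≤ p / 2)]
              exact lintegral_const_mul' _ _
                (ENNReal.rpow_ne_top_of_nonneg (by positivity) (by finiteness))
          _ ≤ _ := by
              rw [hA, mul_assoc]
              gcongr
              exact hC _ hf
    _ ≤ _ := by
        rw [ENNReal.mul_rpow_of_nonneg _ _ (by positivity)]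
        gcongr
        refine (ENNReal.le_ofReal_iff_toReal_le hAtop (by positivity)).2 ?_
        linarith
end
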